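/- Let n ≥ 5 and 1 < p < (n+4)/(n-4), and let u be a nonnegative C⁴ solution of Δ²u = u^p in the exterior domain B₁^c = {x ∈ ℝⁿ : |x| > 1}. Then there exists a constant C₂, depending only on n and p, such that for all x with |x| ≥ 4, one has Σ_{k=0}^{3} |x|^{4/(p-1)+k} |∇^k u(x)| ≤ C₂, where |∇^k u(x)| denotes the norm of the k-th (iterated) derivative of u at x. -/

import Mathlib

open MeasureTheory Metric Filter

/-- The Euclidean Laplacian `Δu` of `u : ℝⁿ → ℝ`, computed as the trace of the second
derivative: `Δu(x) = ∑ i, ∂²u/∂xᵢ²(x)`. -/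
noncomputable def lap {n : ℕ} (u : EuclideanSpace ℝ (Fin n) → ℝ) :
    EuclideanSpace ℝ (Fin n) → ℝ :=
  fun x => ∑ i : Fin n,
    iteratedFDeriv ℝ 2 u x ![EuclideanSpace.single i 1, EuclideanSpace.single i 1]

/-- The biharmonic operator `Δ²u = Δ(Δu)`. -/
noncomputable def bilap {n : ℕ} (u : EuclideanSpace ℝ (Fin n) → ℝ) :
    EuclideanSpace ℝ (Fin n) → ℝ :=
  lap (lap u)

set_option linter.unusedSectionVars false

/-! ### Potentials and inversion -/

section MovingSpheres

variable {E : Type*} [NormedAddCommGroup E] [InnerProductSpace ℝ E] [FiniteDimensional ℝ E]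
  [MeasurableSpace E] [BorelSpace E]

/-- An integrable radial function comparable to `‖z‖ ^ (-(d - 4))` times an admissible weight. -/
noncomputable def potMaj (E : Type*) [NormedAddCommGroup E] [InnerProductSpace ℝ E] (z : E) : ℝ :=
  ‖z‖ ^ (-((Module.finrank ℝ E : ℝ) - 4)) * ((‖z‖ ^ 3)⁻¹ * ((1 + ‖z‖) ^ 2)⁻¹)

lemma potMaj_nonneg (z : E) : 0 ≤ potMaj E z := by unfold potMaj; positivity

lemma rpow_finrank_sub_four_mul {d : ℕ} (hd : 5 ≤ d) {r : ℝ} (hr : 0 < r) :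
    r ^ (d - 1) * r ^ (-((d : ℝ) - 4)) = r ^ 3 := by
  rw [← Real.rpow_natCast, ← Real.rpow_add hr, ← Real.rpow_natCast]
  congr 1
  push_cast [Nat.cast_sub (show 1 ≤ d by lia)]
  ring

lemma integrable_potMaj (hd : 5 ≤ Module.finrank ℝ E) : Integrable (potMaj E) := by
  have : Nontrivial E := Module.nontrivial_of_finrank_pos (R := ℝ) (by lia)
  have h := (integrable_fun_norm_addHaar (volume : Measure E)
    (f := fun r : ℝ => r ^ (-((Module.finrank ℝ E : ℝ) - 4)) * ((r ^ 3)⁻¹ * ((1 + r) ^ 2)⁻¹)))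
  refine h.2 ?_
  have h2 : IntegrableOn (fun r : ℝ => (r + 1) ^ (-2 : ℝ)) (Set.Ioi 0) :=
    integrableOn_add_rpow_Ioi_of_lt (by norm_num) (by norm_num)
  refine h2.congr_fun (fun r hr => ?_) measurableSet_Ioi
  have hr : 0 < r := hr
  have := rpow_finrank_sub_four_mul hd hr
  simp only [smul_eq_mul]
  rw [← mul_assoc, this, Real.rpow_neg (by positivity), add_comm r 1]
  norm_cast
  field_simp

lemma not_integrable_norm_rpow (hd : 5 ≤ Module.finrank ℝ E) :
    ¬ Integrable (fun z : E => ‖z‖ ^ (-((Module.finrank ℝ E : ℝ) - 4))) := by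
  have : Nontrivial E := Module.nontrivial_of_finrank_pos (R := ℝ) (by lia)
  intro hI
  have h := (integrable_fun_norm_addHaar (volume : Measure E)
    (f := fun r : ℝ => r ^ (-((Module.finrank ℝ E : ℝ) - 4)))).1 hI
  have h2 : IntegrableOn (fun r : ℝ => r ^ (3 : ℝ)) (Set.Ioi (1 : ℝ)) := by
    refine (h.mono_set (Set.Ioi_subset_Ioi zero_le_one)).congr_fun (fun r hr => ?_)
      measurableSet_Ioi
    have hr : 0 < r := lt_trans one_pos hr
    have := rpow_finrank_sub_four_mul hd hr
    simp only [smul_eq_mul, this]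
    norm_cast
  rw [integrableOn_Ioi_rpow_iff one_pos] at h2
  norm_num at h2

/-- Rearrangement-type bound. -/
lemma potential_le (hd : 5 ≤ Module.finrank ℝ E) (x y : E) :
    ‖x - y‖ ^ (-((Module.finrank ℝ E : ℝ) - 4)) * ((‖y‖ ^ 3)⁻¹ * ((1 + ‖y‖) ^ 2)⁻¹) ≤
      potMaj E (x - y) + potMaj E y := by
  have hγ : (0 : ℝ) < (Module.finrank ℝ E : ℝ) - 4 := by
    have : (5 : ℝ) ≤ Module.finrank ℝ E := by exact_mod_cast hd
    linarith
  have h1 := potMaj_nonneg (x - y)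
  have h2 := potMaj_nonneg y
  rcases (norm_nonneg (x - y)).eq_or_lt' with h0 | h0
  · rw [h0, Real.zero_rpow (by linarith), zero_mul]; positivity
  rcases (norm_nonneg y).eq_or_lt' with h0' | h0'
  · rw [h0']; simp; positivity
  rcases le_total ‖x - y‖ ‖y‖ with h | h
  · refine le_trans ?_ (le_add_of_nonneg_right h2)
    unfold potMaj
    gcongr
  · refine le_trans ?_ (le_add_of_nonneg_left h1)
    unfold potMaj
    exact mul_le_mul_of_nonneg_right
      (Real.rpow_le_rpow_of_nonpos h0' h (neg_nonpos.2 hγ.le)) (by positivity)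

/-- Weight comparison: `(L / r) ^ 8` against the admissible weight. -/
lemma weight_le {l r : ℝ} (hl : 0 < l) (hl1 : l ≤ 1) (hr : l < r) :
    (l / r) ^ 8 ≤ 4 * l ^ 3 * ((r ^ 3)⁻¹ * ((1 + r) ^ 2)⁻¹) := by
  have hr0 : 0 < r := hl.trans hr
  have hq : 0 ≤ l / r := by positivity
  have hq1 : l / r ≤ 1 := (div_le_one hr0).2 hr.le
  rcases le_total r 1 with h | h
  · calc (l / r) ^ 8 ≤ (l / r) ^ 3 := pow_le_pow_of_le_one hq hq1 (by norm_num)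
      _ = l ^ 3 * (r ^ 3)⁻¹ * 1 := by rw [div_pow]; ring
      _ ≤ l ^ 3 * (r ^ 3)⁻¹ * (4 * ((1 + r) ^ 2)⁻¹) := by
        gcongr
        rw [← div_eq_mul_inv, le_div_iff₀ (by positivity)]
        nlinarith
      _ = _ := by ring
  · calc (l / r) ^ 8 ≤ (l / r) ^ 5 := pow_le_pow_of_le_one hq hq1 (by norm_num)
      _ = l ^ 5 * (r ^ 3)⁻¹ * (r ^ 2)⁻¹ := by rw [div_pow]; field_simp
      _ ≤ l ^ 3 * (r ^ 3)⁻¹ * (4 * ((1 + r) ^ 2)⁻¹) := by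
        gcongr ?_ * _ * ?_
        · exact pow_le_pow_of_le_one hl.le hl1 (by norm_num)
        · rw [← div_eq_mul_inv, inv_eq_one_div, div_le_div_iff₀ (by positivity) (by positivity)]
          nlinarith
      _ = _ := by ring

lemma weight_le_of_large {l L T r : ℝ} (hl : 0 < l) (hL : l ≤ L) (hT : 1 ≤ T) (hr : T < r) :
    (l / r) ^ 8 ≤ 4 * L ^ 8 * (T ^ 3)⁻¹ * ((r ^ 3)⁻¹ * ((1 + r) ^ 2)⁻¹) := by
  have hr0 : 0 < r := by linarith
  calc (l / r) ^ 8 = l ^ 8 * (r ^ 3)⁻¹ * ((r ^ 3)⁻¹ * (r ^ 2)⁻¹) := by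
        rw [div_pow]; field_simp
    _ ≤ L ^ 8 * (T ^ 3)⁻¹ * ((r ^ 3)⁻¹ * (4 * ((1 + r) ^ 2)⁻¹)) := by
        gcongr ?_ * ?_ * (_ * ?_)
        · gcongr
        · gcongr
        · rw [← div_eq_mul_inv, inv_eq_one_div, div_le_div_iff₀ (by positivity) (by positivity)]
          nlinarith
    _ = _ := by ring

/-- Total mass of `potMaj`. -/
noncomputable def potMass (E : Type*) [NormedAddCommGroup E] [InnerProductSpace ℝ E]
    [FiniteDimensional ℝ E] [MeasurableSpace E] [BorelSpace E] : ℝ := ∫ z : E, potMaj E z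

lemma integrable_potMaj_add (hd : 5 ≤ Module.finrank ℝ E) (x : E) :
    Integrable (fun y => potMaj E (x - y) + potMaj E y) :=
  ((integrable_potMaj hd).comp_sub_left x).add (integrable_potMaj hd)

lemma integral_potMaj_add (hd : 5 ≤ Module.finrank ℝ E) (x : E) :
    ∫ y, (potMaj E (x - y) + potMaj E y) = 2 * potMass E := by
  rw [integral_add ((integrable_potMaj hd).comp_sub_left x) (integrable_potMaj hd),
    integral_sub_left_eq_self, potMass]
  ring

lemma potMass_nonneg : 0 ≤ potMass E := integral_nonneg potMaj_nonneg

lemma measurable_potential (x : E) (l : ℝ) : Measurable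
    (fun y : E => ‖x - y‖ ^ (-((Module.finrank ℝ E : ℝ) - 4)) * (l / ‖y‖) ^ 8) := by
  fun_prop

/-- The potential of the weight `(l / ‖y‖) ^ 8` over `{l < ‖y‖}` is small for small `l`. -/
lemma potential_small_radius (hd : 5 ≤ Module.finrank ℝ E) {l : ℝ} (hl : 0 < l) (hl1 : l ≤ 1)
    {A : Set E} (hA : MeasurableSet A) (hAl : A ⊆ {y | l < ‖y‖}) (x : E) :
    IntegrableOn (fun y => ‖x - y‖ ^ (-((Module.finrank ℝ E : ℝ) - 4)) * (l / ‖y‖) ^ 8) A ∧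
    ∫ y in A, ‖x - y‖ ^ (-((Module.finrank ℝ E : ℝ) - 4)) * (l / ‖y‖) ^ 8 ≤
      8 * l ^ 3 * potMass E := by
  have hb : ∀ y ∈ A, ‖x - y‖ ^ (-((Module.finrank ℝ E : ℝ) - 4)) * (l / ‖y‖) ^ 8 ≤
      4 * l ^ 3 * (potMaj E (x - y) + potMaj E y) := fun y hy => by
    calc _ ≤ ‖x - y‖ ^ (-((Module.finrank ℝ E : ℝ) - 4)) *
          (4 * l ^ 3 * ((‖y‖ ^ 3)⁻¹ * ((1 + ‖y‖) ^ 2)⁻¹)) := by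
          gcongr; exact weight_le hl hl1 (hAl hy)
      _ = 4 * l ^ 3 * (‖x - y‖ ^ (-((Module.finrank ℝ E : ℝ) - 4)) *
          ((‖y‖ ^ 3)⁻¹ * ((1 + ‖y‖) ^ 2)⁻¹)) := by ring
      _ ≤ _ := by gcongr; exact potential_le hd x y
  have hI := (integrable_potMaj_add hd x).const_mul (4 * l ^ 3)
  have hInt : IntegrableOn
      (fun y => ‖x - y‖ ^ (-((Module.finrank ℝ E : ℝ) - 4)) * (l / ‖y‖) ^ 8) A := by
    refine hI.integrableOn.mono' (measurable_potential x l).aestronglyMeasurable ?_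
    refine (ae_restrict_iff' hA).2 (Eventually.of_forall fun y hy => ?_)
    rw [Real.norm_of_nonneg (by positivity)]
    exact hb y hy
  refine ⟨hInt, ?_⟩
  calc _ ≤ ∫ y in A, 4 * l ^ 3 * (potMaj E (x - y) + potMaj E y) :=
        setIntegral_mono_on hInt hI.integrableOn hA hb
    _ ≤ ∫ y, 4 * l ^ 3 * (potMaj E (x - y) + potMaj E y) :=
        setIntegral_le_integral hI (Eventually.of_forall fun y => by
          have := potMaj_nonneg (x - y); have := potMaj_nonneg y
          simp only [Pi.zero_apply]; positivity)
    _ = _ := by rw [integral_const_mul, integral_potMaj_add hd]; ring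

/-- The potential of the weight `(l / ‖y‖) ^ 8` over sets whose bounded part is small. -/
lemma potential_small_set (hd : 5 ≤ Module.finrank ℝ E) {L ε : ℝ} (hL : 0 < L) (hε : 0 < ε) :
    ∃ T η : ℝ, 0 < η ∧ ∀ (l : ℝ) (A : Set E), 0 < l → l ≤ L → MeasurableSet A →
      A ⊆ {y | l < ‖y‖} → volume.real (A ∩ closedBall 0 T) ≤ η → ∀ x : E,
    IntegrableOn (fun y => ‖x - y‖ ^ (-((Module.finrank ℝ E : ℝ) - 4)) * (l / ‖y‖) ^ 8) A ∧
    ∫ y in A, ‖x - y‖ ^ (-((Module.finrank ℝ E : ℝ) - 4)) * (l / ‖y‖) ^ 8 ≤ ε := by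
  have hγ : (0 : ℝ) < (Module.finrank ℝ E : ℝ) - 4 := by
    have : (5 : ℝ) ≤ Module.finrank ℝ E := by exact_mod_cast hd
    linarith
  set γ : ℝ := (Module.finrank ℝ E : ℝ) - 4 with hγd
  have hM := potMass_nonneg (E := E)
  set M := potMass E with hMd
  obtain ⟨ρ, hρ0, hρ1, hρ⟩ : ∃ ρ : ℝ, 0 < ρ ∧ ρ ≤ 1 ∧ 8 * M * ρ ^ 3 ≤ ε / 3 := by
    refine ⟨min 1 (ε / (24 * (M + 1))), by positivity, min_le_left _ _, ?_⟩
    have h1 : min 1 (ε / (24 * (M + 1))) ^ 3 ≤ ε / (24 * (M + 1)) := by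
      calc min 1 (ε / (24 * (M + 1))) ^ 3 ≤ min 1 (ε / (24 * (M + 1))) ^ 1 :=
            pow_le_pow_of_le_one (by positivity) (min_le_left _ _) (by norm_num)
        _ ≤ _ := by rw [pow_one]; exact min_le_right _ _
    calc _ ≤ 8 * (M + 1) * (ε / (24 * (M + 1))) := by gcongr; linarith
      _ = ε / 3 := by field_simp; norm_num
  obtain ⟨T, hT1, hT⟩ : ∃ T : ℝ, 1 ≤ T ∧ 8 * L ^ 8 * M * (T ^ 3)⁻¹ ≤ ε / 3 := by
    refine ⟨1 + 24 * L ^ 8 * M / ε, by simp; positivity, ?_⟩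
    rw [← div_eq_mul_inv, div_le_iff₀ (by positivity)]
    have hz : 0 ≤ 24 * L ^ 8 * M / ε := by positivity
    calc 8 * L ^ 8 * M = ε / 3 * (24 * L ^ 8 * M / ε) := by field_simp; ring
      _ ≤ ε / 3 * (1 + 24 * L ^ 8 * M / ε) ^ 3 := by
        gcongr; nlinarith [pow_pos (show 0 < 1 + 24 * L ^ 8 * M / ε by positivity) 2]
  refine ⟨T, ε / 3 * ρ ^ γ, by positivity, fun l A hl hlL hA hAl hvol x => ?_⟩
  set B := A ∩ closedBall (0 : E) T with hB
  have hBm : MeasurableSet B := hA.inter measurableSet_closedBall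
  have hBf : volume B ≠ ⊤ := ((measure_mono Set.inter_subset_right).trans_lt
    measure_closedBall_lt_top).ne
  set F : E → ℝ := fun y => 4 * ρ ^ 3 * (potMaj E (x - y) + potMaj E y) +
    B.indicator (fun _ => ρ ^ (-γ)) y +
    4 * L ^ 8 * (T ^ 3)⁻¹ * (potMaj E (x - y) + potMaj E y) with hF
  have hp : ∀ y, 0 ≤ potMaj E (x - y) + potMaj E y := fun y =>
    add_nonneg (potMaj_nonneg _) (potMaj_nonneg _)
  have hind : ∀ y, 0 ≤ B.indicator (fun _ => ρ ^ (-γ)) y := fun y =>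
    Set.indicator_nonneg (fun _ _ => by positivity) y
  have hF0 : ∀ y, 0 ≤ F y := fun y => by
    have := hp y; have := hind y; simp only [hF]; positivity
  have hIi : Integrable (B.indicator (fun _ : E => ρ ^ (-γ))) :=
    (integrable_indicator_iff hBm).2 (integrableOn_const hBf)
  have hI : Integrable F := (((integrable_potMaj_add hd x).const_mul _).add hIi).add
    ((integrable_potMaj_add hd x).const_mul _)
  have hb : ∀ y ∈ A, ‖x - y‖ ^ (-γ) * (l / ‖y‖) ^ 8 ≤ F y := fun y hy => by
    have hly : l < ‖y‖ := hAl hy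
    have hy0 : 0 < ‖y‖ := hl.trans hly
    have h1 := hp y
    have h2 := hind y
    have hw1 : (l / ‖y‖) ^ 8 ≤ 1 :=
      pow_le_one₀ (by positivity) ((div_le_one hy0).2 hly.le)
    rcases le_or_gt ‖y‖ T with hyT | hyT
    · rcases le_or_gt ρ ‖x - y‖ with hxy | hxy
      · have hyB : y ∈ B := ⟨hy, by simpa using hyT⟩
        have : ‖x - y‖ ^ (-γ) * (l / ‖y‖) ^ 8 ≤ B.indicator (fun _ => ρ ^ (-γ)) y := by
          rw [Set.indicator_of_mem hyB]
          calc _ ≤ ρ ^ (-γ) * 1 := by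
                gcongr ?_ * ?_
                exact Real.rpow_le_rpow_of_nonpos hρ0 hxy (by linarith)
            _ = _ := mul_one _
        have h3 : 0 ≤ 4 * ρ ^ 3 * (potMaj E (x - y) + potMaj E y) := by positivity
        have h4 : 0 ≤ 4 * L ^ 8 * (T ^ 3)⁻¹ * (potMaj E (x - y) + potMaj E y) := by positivity
        simp only [hF]; linarith
      · have h3 : ‖x - y‖ ^ (-γ) ≤ 4 * ρ ^ 3 * potMaj E (x - y) := by
          rcases (norm_nonneg (x - y)).eq_or_lt' with h0 | h0
          · rw [h0, Real.zero_rpow (by linarith)]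
            have := potMaj_nonneg (x - y); positivity
          · unfold potMaj
            rw [← hγd]
            calc ‖x - y‖ ^ (-γ) = ‖x - y‖ ^ (-γ) * 1 := (mul_one _).symm
              _ ≤ ‖x - y‖ ^ (-γ) *
                  (4 * ρ ^ 3 * ((‖x - y‖ ^ 3)⁻¹ * ((1 + ‖x - y‖) ^ 2)⁻¹)) := by
                gcongr
                rw [← mul_inv, ← div_eq_mul_inv, le_div_iff₀ (by positivity)]
                have : ‖x - y‖ ^ 3 ≤ ρ ^ 3 := by gcongr
                have : (1 + ‖x - y‖) ^ 2 ≤ 4 := by nlinarith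
                calc _ = (‖x - y‖ ^ 3) * (1 + ‖x - y‖) ^ 2 := by ring
                  _ ≤ ρ ^ 3 * 4 := by gcongr
                  _ = _ := by ring
              _ = _ := by ring
        have h4 : ‖x - y‖ ^ (-γ) * (l / ‖y‖) ^ 8 ≤ 4 * ρ ^ 3 * potMaj E (x - y) :=
          (mul_le_of_le_one_right (by positivity) hw1).trans h3
        have h5 : 0 ≤ 4 * ρ ^ 3 * potMaj E y := by have := potMaj_nonneg y; positivity
        have h6 : 0 ≤ 4 * L ^ 8 * (T ^ 3)⁻¹ * (potMaj E (x - y) + potMaj E y) := by positivity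
        simp only [hF]; linarith
    · have : ‖x - y‖ ^ (-γ) * (l / ‖y‖) ^ 8 ≤
          4 * L ^ 8 * (T ^ 3)⁻¹ * (potMaj E (x - y) + potMaj E y) := by
        calc _ ≤ ‖x - y‖ ^ (-γ) *
              (4 * L ^ 8 * (T ^ 3)⁻¹ * ((‖y‖ ^ 3)⁻¹ * ((1 + ‖y‖) ^ 2)⁻¹)) := by
              gcongr; exact weight_le_of_large hl hlL hT1 hyT
          _ = 4 * L ^ 8 * (T ^ 3)⁻¹ * (‖x - y‖ ^ (-γ) *
              ((‖y‖ ^ 3)⁻¹ * ((1 + ‖y‖) ^ 2)⁻¹)) := by ring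
          _ ≤ _ := by gcongr; exact potential_le hd x y
      have h3 : 0 ≤ 4 * ρ ^ 3 * (potMaj E (x - y) + potMaj E y) := by positivity
      simp only [hF]; linarith
  have hInt : IntegrableOn (fun y => ‖x - y‖ ^ (-γ) * (l / ‖y‖) ^ 8) A := by
    refine hI.integrableOn.mono' (measurable_potential x l).aestronglyMeasurable ?_
    refine (ae_restrict_iff' hA).2 (Eventually.of_forall fun y hy => ?_)
    rw [Real.norm_of_nonneg (by positivity)]
    exact hb y hy
  refine ⟨hInt, ?_⟩
  calc _ ≤ ∫ y in A, F y := setIntegral_mono_on hInt hI.integrableOn hA hb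
    _ ≤ ∫ y, F y := setIntegral_le_integral hI (Eventually.of_forall hF0)
    _ = 8 * M * ρ ^ 3 + volume.real B * ρ ^ (-γ) + 8 * L ^ 8 * M * (T ^ 3)⁻¹ := by
      have e1 := integral_add ((integrable_potMaj_add hd x).const_mul (4 * ρ ^ 3)) hIi
      have e2 := integral_add (((integrable_potMaj_add hd x).const_mul (4 * ρ ^ 3)).add hIi)
        ((integrable_potMaj_add hd x).const_mul (4 * L ^ 8 * (T ^ 3)⁻¹))
      simp only [Pi.add_apply] at e1 e2
      simp only [hF]
      rw [e2, e1, integral_const_mul, integral_const_mul, integral_potMaj_add hd,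
        integral_indicator hBm, setIntegral_const, smul_eq_mul]
      ring
    _ ≤ ε / 3 + (ε / 3 * ρ ^ γ) * ρ ^ (-γ) + ε / 3 := by gcongr
    _ = ε := by
      rw [mul_assoc, ← Real.rpow_add hρ0, add_neg_cancel, Real.rpow_zero]; ring

end MovingSpheres

section MovingSpheres

variable {E : Type*} [NormedAddCommGroup E] [InnerProductSpace ℝ E] [FiniteDimensional ℝ E]
  [MeasurableSpace E] [BorelSpace E]

/-- Inversion in the sphere of radius `l` centred at the origin. -/
noncomputable def inv0 (l : ℝ) (y : E) : E := (l / ‖y‖) ^ 2 • y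

lemma inv0_eq_inversion (l : ℝ) : (inv0 l : E → E) = EuclideanGeometry.inversion 0 l := by
  funext y
  simp [inv0, EuclideanGeometry.inversion]

lemma norm_inv0 {l : ℝ} {y : E} (hy : y ≠ 0) : ‖inv0 l y‖ = l ^ 2 / ‖y‖ := by
  have : ‖y‖ ≠ 0 := norm_ne_zero_iff.2 hy
  rw [inv0, norm_smul, norm_pow, norm_div, norm_norm, Real.norm_eq_abs, div_pow, sq_abs]
  field_simp

lemma inv0_inv0 {l : ℝ} (hl : l ≠ 0) (y : E) : inv0 l (inv0 l y) = y := by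
  rw [inv0_eq_inversion, EuclideanGeometry.inversion_inversion _ hl]

lemma inv0_ne_zero {l : ℝ} (hl : l ≠ 0) {y : E} (hy : y ≠ 0) : inv0 l y ≠ 0 := by
  have : ‖y‖ ≠ 0 := norm_ne_zero_iff.2 hy
  simp [inv0, hl, hy]

lemma norm_inv0_sub_inv0 {l : ℝ} {x y : E} (hx : x ≠ 0) (hy : y ≠ 0) :
    ‖inv0 l x - inv0 l y‖ = l ^ 2 / (‖x‖ * ‖y‖) * ‖x - y‖ := by
  have := EuclideanGeometry.dist_inversion_inversion hx hy l
  simpa [inv0_eq_inversion, dist_eq_norm] using this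

lemma norm_inv0_sub {l : ℝ} (hl : l ≠ 0) {x y : E} (hx : x ≠ 0) (hy : y ≠ 0) :
    ‖inv0 l x - y‖ * ‖x‖ = ‖x - inv0 l y‖ * ‖y‖ := by
  have h := norm_inv0_sub_inv0 (l := l) hx (inv0_ne_zero hl hy)
  have : ‖x‖ ≠ 0 := norm_ne_zero_iff.2 hx
  have : ‖y‖ ≠ 0 := norm_ne_zero_iff.2 hy
  rw [inv0_inv0 hl, norm_inv0 hy] at h
  rw [h]
  field_simp

lemma norm_sub_inv0_sq_sub_sq {l : ℝ} (hl : 0 < l) {x y : E} (hy : l ≤ ‖y‖) :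
    (‖y‖ / l * ‖x - inv0 l y‖) ^ 2 - ‖x - y‖ ^ 2 =
      (‖x‖ ^ 2 - l ^ 2) * (‖y‖ ^ 2 - l ^ 2) / l ^ 2 := by
  have hy0 : 0 < ‖y‖ := hl.trans_le hy
  rw [mul_pow, norm_sub_sq_real, norm_sub_sq_real, norm_inv0 (norm_pos_iff.1 hy0), inv0,
    real_inner_smul_right]
  field_simp
  ring

lemma inv0_image {l : ℝ} (hl : 0 < l) :
    (inv0 l : E → E) '' {y | l < ‖y‖} = ball 0 l \ {0} := by
  ext z
  constructor
  · rintro ⟨y, hy, rfl⟩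
    have hy : l < ‖y‖ := hy
    have hy0 : 0 < ‖y‖ := hl.trans hy
    have hy1 : y ≠ 0 := norm_pos_iff.1 hy0
    refine ⟨?_, inv0_ne_zero hl.ne' hy1⟩
    rw [mem_ball_zero_iff, norm_inv0 hy1, div_lt_iff₀ hy0]
    nlinarith
  · rintro ⟨hz, hz0⟩
    rw [mem_ball_zero_iff] at hz
    have hz0 : z ≠ 0 := hz0
    have hzp : 0 < ‖z‖ := norm_pos_iff.2 hz0
    refine ⟨inv0 l z, ?_, inv0_inv0 hl.ne' z⟩
    change l < ‖inv0 l z‖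
    rw [norm_inv0 hz0, lt_div_iff₀ hzp]
    nlinarith

lemma abs_det_inversion (l : ℝ) (x : E) :
    |(((l / ‖x‖) ^ 2 • ((ℝ ∙ x)ᗮ.reflection : E →L[ℝ] E)) : E →L[ℝ] E).det| =
      (l / ‖x‖) ^ (2 * Module.finrank ℝ E) := by
  rw [ContinuousLinearMap.det]
  have h := Submodule.det_reflection (𝕜 := ℝ) (K := (ℝ ∙ x)ᗮ)
  have e : (((l / ‖x‖) ^ 2 • ((ℝ ∙ x)ᗮ.reflection : E →L[ℝ] E) : E →L[ℝ] E) : E →ₗ[ℝ] E) =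
      (l / ‖x‖) ^ 2 • ((ℝ ∙ x)ᗮ.reflection).toLinearMap := rfl
  rw [e, LinearMap.det_smul, h, abs_mul, abs_pow, abs_pow (-1 : ℝ), abs_neg, abs_one, one_pow,
    mul_one, abs_of_nonneg (by positivity), pow_mul]

/-- Folding an integral over the space onto the exterior of a ball by inversion. -/
lemma integral_inv0 [Nontrivial E] {l : ℝ} (hl : 0 < l) {h : E → ℝ} (hh : Integrable h) :
    IntegrableOn (fun y => (l / ‖y‖) ^ (2 * Module.finrank ℝ E) * h (inv0 l y)) {y | l < ‖y‖} ∧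
    ∫ y, h y = (∫ y in {y : E | l < ‖y‖}, h y) +
      ∫ y in {y : E | l < ‖y‖}, (l / ‖y‖) ^ (2 * Module.finrank ℝ E) * h (inv0 l y) := by
  have hm : MeasurableSet {y : E | l < ‖y‖} := measurableSet_lt measurable_const measurable_norm
  have hder : ∀ x ∈ {y : E | l < ‖y‖}, HasFDerivWithinAt (inv0 l : E → E)
      ((l / ‖x‖) ^ 2 • ((ℝ ∙ x)ᗮ.reflection : E →L[ℝ] E)) {y : E | l < ‖y‖} x := by
    intro x hx
    have hx : l < ‖x‖ := hx
    have hx0 : x ≠ 0 := norm_pos_iff.1 (hl.trans hx)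
    have := (EuclideanGeometry.hasFDerivAt_inversion (R := l) hx0).hasFDerivWithinAt
      (s := {y : E | l < ‖y‖})
    rw [← inv0_eq_inversion, dist_zero_right] at this
    simpa using this
  have hinj : Set.InjOn (inv0 l : E → E) {y : E | l < ‖y‖} := fun a _ b _ hab => by
    rw [← inv0_inv0 hl.ne' a, hab, inv0_inv0 hl.ne' b]
  have h1 := integrableOn_image_iff_integrableOn_abs_det_fderiv_smul volume hm hder hinj h
  have h2 := integral_image_eq_integral_abs_det_fderiv_smul volume hm hder hinj h
  simp only [abs_det_inversion, smul_eq_mul] at h1 h2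
  refine ⟨h1.1 hh.integrableOn, ?_⟩
  rw [← h2, inv0_image hl, ← integral_add_compl hm hh]
  congr 1
  refine setIntegral_congr_set ?_
  have hc : ({y : E | l < ‖y‖}ᶜ : Set E) = closedBall 0 l := by ext; simp
  rw [hc]
  have e1 : (ball (0 : E) l \ {0} : Set E) =ᵐ[volume] ball (0 : E) l :=
    sdiff_ae_eq_self.2 (measure_mono_null Set.inter_subset_right (measure_singleton _))
  refine EventuallyEq.trans ?_ e1.symm
  have := Measure.addHaar_sphere (volume : Measure E) 0 l
  rw [← ball_union_sphere]
  exact union_ae_eq_left_of_ae_eq_empty (ae_eq_empty.2 this)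

/-- The moving-sphere difference `u_l - u`. -/
noncomputable def sphDiff (u : E → ℝ) (l : ℝ) (x : E) : ℝ :=
  (l / ‖x‖) ^ ((Module.finrank ℝ E : ℝ) - 4) * u (inv0 l x) - u x

/-- The folded kernel. -/
noncomputable def sphKer (l : ℝ) (x y : E) : ℝ :=
  ‖x - y‖ ^ (-((Module.finrank ℝ E : ℝ) - 4)) -
    (l / ‖y‖) ^ ((Module.finrank ℝ E : ℝ) - 4) *
      ‖x - inv0 l y‖ ^ (-((Module.finrank ℝ E : ℝ) - 4))

lemma integral_sub_sub_add {α : Type*} [MeasurableSpace α] {μ : Measure α} {f g h k : α → ℝ}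
    (hf : Integrable f μ) (hg : Integrable g μ) (hh : Integrable h μ) (hk : Integrable k μ) :
    Integrable (fun x => f x - g x - h x + k x) μ ∧
    ∫ x, (f x - g x - h x + k x) ∂μ =
      ∫ x, f x ∂μ - ∫ x, g x ∂μ - ∫ x, h x ∂μ + ∫ x, k x ∂μ := by
  refine ⟨((hf.sub hg).sub hh).add hk, ?_⟩
  rw [integral_add (f := fun x => f x - g x - h x) ((hf.sub hg).sub hh) hk,
    integral_sub (f := fun x => f x - g x) (hf.sub hg) hh, integral_sub hf hg]

lemma sphDiff_eq_integral (hd : 5 ≤ Module.finrank ℝ E) {p κ : ℝ} {u : E → ℝ}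
    (hInt : ∀ x, Integrable (fun y => ‖x - y‖ ^ (-((Module.finrank ℝ E : ℝ) - 4)) * u y ^ p))
    (heq : ∀ x, u x = κ * ∫ y, ‖x - y‖ ^ (-((Module.finrank ℝ E : ℝ) - 4)) * u y ^ p)
    {l : ℝ} (hl : 0 < l) {x : E} (hx : x ≠ 0) :
    IntegrableOn (fun y => sphKer l x y *
      ((l / ‖y‖) ^ ((Module.finrank ℝ E : ℝ) + 4) * u (inv0 l y) ^ p - u y ^ p))
      {y | l < ‖y‖} ∧
    sphDiff u l x = κ * ∫ y in {y : E | l < ‖y‖}, sphKer l x y *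
      ((l / ‖y‖) ^ ((Module.finrank ℝ E : ℝ) + 4) * u (inv0 l y) ^ p - u y ^ p) := by
  have : Nontrivial E := Module.nontrivial_of_finrank_pos (R := ℝ) (by lia)
  set d := Module.finrank ℝ E with hdd
  set γ : ℝ := (d : ℝ) - 4 with hγ
  have hm : MeasurableSet {y : E | l < ‖y‖} := measurableSet_lt measurable_const measurable_norm
  have hx0 : 0 < ‖x‖ := norm_pos_iff.2 hx
  obtain ⟨i1, e1⟩ := integral_inv0 hl (hInt x)
  obtain ⟨i2, e2⟩ := integral_inv0 hl (hInt (inv0 l x))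
  have j1 : IntegrableOn (fun y => ‖x - y‖ ^ (-γ) * u y ^ p) {y : E | l < ‖y‖} :=
    (hInt x).integrableOn
  have j2 : IntegrableOn (fun y => ‖inv0 l x - y‖ ^ (-γ) * u y ^ p) {y : E | l < ‖y‖} :=
    (hInt _).integrableOn
  have hpt : ∀ y ∈ {y : E | l < ‖y‖}, sphKer l x y *
      ((l / ‖y‖) ^ ((d : ℝ) + 4) * u (inv0 l y) ^ p - u y ^ p) =
      (l / ‖x‖) ^ γ * ((l / ‖y‖) ^ (2 * d) *
        (‖inv0 l x - inv0 l y‖ ^ (-γ) * u (inv0 l y) ^ p)) -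
      ‖x - y‖ ^ (-γ) * u y ^ p -
      (l / ‖y‖) ^ (2 * d) * (‖x - inv0 l y‖ ^ (-γ) * u (inv0 l y) ^ p) +
      (l / ‖x‖) ^ γ * (‖inv0 l x - y‖ ^ (-γ) * u y ^ p) := by
    intro y hy
    have hy : l < ‖y‖ := hy
    have hy0 : 0 < ‖y‖ := hl.trans hy
    have hy1 : y ≠ 0 := norm_pos_iff.1 hy0
    have hq : 0 < l / ‖y‖ := by positivity
    have c1 : (l / ‖y‖) ^ γ * (l / ‖y‖) ^ ((d : ℝ) + 4) = (l / ‖y‖) ^ (2 * d) := by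
      rw [← Real.rpow_add hq, ← Real.rpow_natCast]; congr 1; push_cast; rw [hγ]; ring
    have c2 : (l / ‖x‖) ^ γ * ‖inv0 l x - y‖ ^ (-γ) =
        (l / ‖y‖) ^ γ * ‖x - inv0 l y‖ ^ (-γ) := by
      have h := norm_inv0_sub hl.ne' hx hy1
      rw [Real.rpow_neg (norm_nonneg _), Real.rpow_neg (norm_nonneg _), ← Real.inv_rpow
        (norm_nonneg _), ← Real.inv_rpow (norm_nonneg _), ← Real.mul_rpow (by positivity)
        (by positivity), ← Real.mul_rpow (by positivity) (by positivity)]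
      congr 1
      rw [div_mul_eq_mul_div, div_mul_eq_mul_div, mul_comm, mul_comm l, mul_div_assoc,
        mul_div_assoc, inv_mul_eq_div, inv_mul_eq_div, div_div, div_div, mul_comm ‖x‖, h]
      rw [mul_comm ‖y‖]
    have c3 : (l / ‖x‖) ^ γ * ‖inv0 l x - inv0 l y‖ ^ (-γ) * (l / ‖y‖) ^ γ =
        ‖x - y‖ ^ (-γ) := by
      rw [norm_inv0_sub_inv0 hx hy1, Real.rpow_neg (by positivity), Real.rpow_neg (norm_nonneg _),
        ← Real.inv_rpow (by positivity), ← Real.inv_rpow (norm_nonneg _),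
        ← Real.mul_rpow (by positivity) (by positivity),
        ← Real.mul_rpow (by positivity) (by positivity)]
      congr 1
      rw [mul_inv, inv_div]
      field_simp
    unfold sphKer
    rw [← c1, ← c3]
    linear_combination -(u y ^ p) * c2
  obtain ⟨k, ek⟩ := integral_sub_sub_add (i2.const_mul ((l / ‖x‖) ^ γ)) j1 i1
    (j2.const_mul ((l / ‖x‖) ^ γ))
  refine ⟨IntegrableOn.congr_fun k (fun y hy => (hpt y hy).symm) hm, ?_⟩
  rw [setIntegral_congr_fun hm hpt, sphDiff, heq x, heq (inv0 l x), e1, e2, ek,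
    integral_const_mul, integral_const_mul]
  ring

end MovingSpheres

section MovingSpheres

variable {E : Type*} [NormedAddCommGroup E] [InnerProductSpace ℝ E] [FiniteDimensional ℝ E]
  [MeasurableSpace E] [BorelSpace E]

open Topology

lemma sphKer_le (l : ℝ) (hl : 0 < l) (x y : E) :
    sphKer l x y ≤ ‖x - y‖ ^ (-((Module.finrank ℝ E : ℝ) - 4)) := by
  unfold sphKer
  have : 0 ≤ (l / ‖y‖) ^ ((Module.finrank ℝ E : ℝ) - 4) *
      ‖x - inv0 l y‖ ^ (-((Module.finrank ℝ E : ℝ) - 4)) := by positivity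
  linarith

lemma sphKer_eq {l : ℝ} (hl : 0 < l) (x : E) {y : E} (hy : 0 < ‖y‖) :
    sphKer l x y = ‖x - y‖ ^ (-((Module.finrank ℝ E : ℝ) - 4)) -
      (‖y‖ / l * ‖x - inv0 l y‖) ^ (-((Module.finrank ℝ E : ℝ) - 4)) := by
  have e : (‖y‖ / l) ^ (-((Module.finrank ℝ E : ℝ) - 4)) =
      (l / ‖y‖) ^ ((Module.finrank ℝ E : ℝ) - 4) := by
    rw [Real.rpow_neg (by positivity), ← Real.inv_rpow (by positivity), inv_div]
  rw [sphKer, Real.mul_rpow (by positivity) (by positivity), e]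

lemma sphKer_nonneg (hd : 5 ≤ Module.finrank ℝ E) {l : ℝ} (hl : 0 < l) {x y : E} (hxy : x ≠ y)
    (hx : l ≤ ‖x‖) (hy : l ≤ ‖y‖) : 0 ≤ sphKer l x y := by
  have hγ : (5 : ℝ) ≤ Module.finrank ℝ E := by exact_mod_cast hd
  have hy0 : 0 < ‖y‖ := hl.trans_le hy
  have h := norm_sub_inv0_sq_sub_sq hl (x := x) hy
  have h2 : 0 ≤ (‖x‖ ^ 2 - l ^ 2) * (‖y‖ ^ 2 - l ^ 2) / l ^ 2 := by
    have : l ^ 2 ≤ ‖x‖ ^ 2 := by gcongr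
    have : l ^ 2 ≤ ‖y‖ ^ 2 := by gcongr
    exact div_nonneg (mul_nonneg (by linarith) (by linarith)) (by positivity)
  have h3 : ‖x - y‖ ≤ ‖y‖ / l * ‖x - inv0 l y‖ := by
    refine le_of_sq_le_sq ?_ (by positivity)
    linarith
  rw [sphKer_eq hl x hy0, sub_nonneg]
  exact Real.rpow_le_rpow_of_nonpos (norm_pos_iff.2 (sub_ne_zero.2 hxy)) h3 (by linarith)

lemma sphKer_pos (hd : 5 ≤ Module.finrank ℝ E) {l : ℝ} (hl : 0 < l) {x y : E} (hxy : x ≠ y)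
    (hx : l < ‖x‖) (hy : l < ‖y‖) : 0 < sphKer l x y := by
  have hγ : (5 : ℝ) ≤ Module.finrank ℝ E := by exact_mod_cast hd
  have hy0 : 0 < ‖y‖ := hl.trans hy
  have h := norm_sub_inv0_sq_sub_sq hl (x := x) hy.le
  have h2 : 0 < (‖x‖ ^ 2 - l ^ 2) * (‖y‖ ^ 2 - l ^ 2) / l ^ 2 := by
    have : l ^ 2 < ‖x‖ ^ 2 := by gcongr
    have : l ^ 2 < ‖y‖ ^ 2 := by gcongr
    exact div_pos (mul_pos (by linarith) (by linarith)) (by positivity)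
  have h3 : ‖x - y‖ < ‖y‖ / l * ‖x - inv0 l y‖ := by
    refine lt_of_pow_lt_pow_left₀ 2 (by positivity) ?_
    linarith
  rw [sphKer_eq hl x hy0, sub_pos]
  exact Real.rpow_lt_rpow_of_neg (norm_pos_iff.2 (sub_ne_zero.2 hxy)) h3 (by linarith)

lemma rpow_sub_rpow_le {p a b : ℝ} (hp : 1 ≤ p) (ha : 0 ≤ a) (hb : 0 < b) :
    b ^ p - a ^ p ≤ p * b ^ (p - 1) * (b - a) := by
  have h := one_add_mul_self_le_rpow_one_add (s := a / b - 1) (by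
    have : 0 ≤ a / b := by positivity
    linarith) hp
  rw [add_sub_cancel, Real.div_rpow ha hb.le, le_div_iff₀ (by positivity)] at h
  have e : b ^ p = b ^ (p - 1) * b := by
    rw [← Real.rpow_add_one hb.ne', sub_add_cancel]
  have : b ^ p * (a / b) = b ^ (p - 1) * a := by rw [e]; field_simp
  nlinarith

/-- The reflected nonlinearity in terms of the reflected function. -/
lemma sph_rhs_eq {d : ℕ} {p q v : ℝ} (hq : 0 < q) (hv : 0 ≤ v) :
    q ^ ((d : ℝ) + 4) * v ^ p =
      q ^ ((d : ℝ) + 4 - ((d : ℝ) - 4) * p) * (q ^ ((d : ℝ) - 4) * v) ^ p := by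
  rw [Real.mul_rpow (by positivity) hv, ← Real.rpow_mul hq.le, ← mul_assoc, ← Real.rpow_add hq]
  congr 2
  ring

lemma sph_rhs_neg {d : ℕ} {p q v b : ℝ} (hp : 1 < p) (hpd : ((d : ℝ) - 4) * p < d + 4)
    (hq : 0 < q) (hq1 : q < 1) (hv : 0 ≤ v) (hb : 0 < b) (h : q ^ ((d : ℝ) - 4) * v ≤ b) :
    q ^ ((d : ℝ) + 4) * v ^ p - b ^ p < 0 := by
  rw [sph_rhs_eq hq hv, sub_neg]
  calc _ ≤ q ^ ((d : ℝ) + 4 - ((d : ℝ) - 4) * p) * b ^ p := by gcongr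
    _ < 1 * b ^ p := by
      gcongr
      exact Real.rpow_lt_one hq.le hq1 (by linarith)
    _ = _ := one_mul _

lemma sph_rhs_nonpos {d : ℕ} {p q v b : ℝ} (hp : 1 < p) (hpd : ((d : ℝ) - 4) * p < d + 4)
    (hq : 0 < q) (hq1 : q ≤ 1) (hv : 0 ≤ v) (hb : 0 ≤ b) (h : q ^ ((d : ℝ) - 4) * v ≤ b) :
    q ^ ((d : ℝ) + 4) * v ^ p - b ^ p ≤ 0 := by
  rw [sph_rhs_eq hq hv, sub_nonpos]
  calc _ ≤ q ^ ((d : ℝ) + 4 - ((d : ℝ) - 4) * p) * b ^ p := by gcongr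
    _ ≤ 1 * b ^ p := by
      gcongr
      exact Real.rpow_le_one hq.le hq1 (by linarith)
    _ = _ := one_mul _

lemma sph_rhs_le {d : ℕ} {p q v b B m : ℝ} (hp : 1 < p) (hpd : ((d : ℝ) - 4) * p < d + 4)
    (hq : 0 < q) (hq1 : q ≤ 1) (hv : 0 ≤ v) (hvB : v ≤ B) (hb : 0 ≤ b)
    (h0 : 0 < q ^ ((d : ℝ) - 4) * v - b) (h : q ^ ((d : ℝ) - 4) * v - b ≤ m) :
    q ^ ((d : ℝ) + 4) * v ^ p - b ^ p ≤ p * B ^ (p - 1) * m * q ^ 8 := by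
  have hV : 0 < q ^ ((d : ℝ) - 4) * v := by linarith
  set V := q ^ ((d : ℝ) - 4) * v with hVd
  have hτ : q ^ ((d : ℝ) + 4 - ((d : ℝ) - 4) * p) ≤ 1 := Real.rpow_le_one hq.le hq1 (by linarith)
  have hB : 0 ≤ B := hv.trans hvB
  rw [sph_rhs_eq hq hv, ← hVd]
  calc _ ≤ q ^ ((d : ℝ) + 4 - ((d : ℝ) - 4) * p) * (V ^ p - b ^ p) := by
        have : 0 ≤ b ^ p := by positivity
        nlinarith
    _ ≤ q ^ ((d : ℝ) + 4 - ((d : ℝ) - 4) * p) * (p * V ^ (p - 1) * (V - b)) := by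
        gcongr; exact rpow_sub_rpow_le hp.le hb hV
    _ ≤ q ^ ((d : ℝ) + 4 - ((d : ℝ) - 4) * p) *
          (p * (q ^ ((d : ℝ) - 4) * B) ^ (p - 1) * m) := by
        have : 0 ≤ p - 1 := by linarith
        gcongr
        rw [hVd]
        gcongr
    _ = _ := by
        rw [Real.mul_rpow (by positivity) hB, ← Real.rpow_mul hq.le]
        have : q ^ ((d : ℝ) + 4 - ((d : ℝ) - 4) * p) * q ^ (((d : ℝ) - 4) * (p - 1)) =
            q ^ 8 := by
          rw [← Real.rpow_add hq, ← Real.rpow_natCast]; congr 1; push_cast; ring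
        rw [← this]; ring

lemma measurable_inv0 (l : ℝ) : Measurable (inv0 l : E → E) := by unfold inv0; fun_prop

lemma measurable_sphDiff {u : E → ℝ} (hu : Continuous u) (l : ℝ) :
    Measurable (sphDiff u l) := by
  unfold sphDiff
  have := hu.measurable.comp (measurable_inv0 (E := E) l)
  have h2 := hu.measurable
  exact (Measurable.mul (by fun_prop) this).sub h2

/-- The open region where the moving-sphere inequality fails. -/
def sphBad (u : E → ℝ) (l : ℝ) : Set E := {y | l < ‖y‖ ∧ 0 < sphDiff u l y}

lemma measurableSet_sphBad {u : E → ℝ} (hu : Continuous u) (l : ℝ) :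
    MeasurableSet (sphBad u l) :=
  (measurableSet_lt measurable_const measurable_norm).inter
    (measurableSet_lt measurable_const (measurable_sphDiff hu l))

lemma sphDiff_nonpos_of_potential_small (hd : 5 ≤ Module.finrank ℝ E) {p κ B : ℝ} {u : E → ℝ}
    (hp : 1 < p) (hpd : ((Module.finrank ℝ E : ℝ) - 4) * p < Module.finrank ℝ E + 4)
    (hκ : 0 ≤ κ) (hu : Continuous u) (hu0 : ∀ x, 0 ≤ u x) (huB : ∀ x, u x ≤ B)
    (hInt : ∀ x, Integrable (fun y => ‖x - y‖ ^ (-((Module.finrank ℝ E : ℝ) - 4)) * u y ^ p))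
    (heq : ∀ x, u x = κ * ∫ y, ‖x - y‖ ^ (-((Module.finrank ℝ E : ℝ) - 4)) * u y ^ p)
    {l ε : ℝ} (hl : 0 < l) (hε : κ * (p * B ^ (p - 1)) * ε ≤ 1 / 2)
    (hpot : ∀ x : E, IntegrableOn
      (fun y => ‖x - y‖ ^ (-((Module.finrank ℝ E : ℝ) - 4)) * (l / ‖y‖) ^ 8) (sphBad u l) ∧
      ∫ y in sphBad u l, ‖x - y‖ ^ (-((Module.finrank ℝ E : ℝ) - 4)) * (l / ‖y‖) ^ 8 ≤ ε) :
    ∀ x : E, l ≤ ‖x‖ → sphDiff u l x ≤ 0 := by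
  have : Nontrivial E := Module.nontrivial_of_finrank_pos (R := ℝ) (by lia)
  have hγ : (5 : ℝ) ≤ Module.finrank ℝ E := by exact_mod_cast hd
  have hB : 0 ≤ B := (hu0 0).trans (huB 0)
  have hS : MeasurableSet {y : E | l < ‖y‖} := measurableSet_lt measurable_const measurable_norm
  have hA := measurableSet_sphBad hu l
  have hAS : sphBad u l ⊆ {y : E | l < ‖y‖} := fun y hy => hy.1
  have step : ∀ m : ℝ, 0 ≤ m → (∀ x : E, l ≤ ‖x‖ → sphDiff u l x ≤ m) →
      ∀ x : E, l ≤ ‖x‖ → sphDiff u l x ≤ m / 2 := by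
    intro m hm hw x hx
    have hx0 : x ≠ 0 := norm_pos_iff.1 (hl.trans_le hx)
    obtain ⟨i1, e1⟩ := sphDiff_eq_integral hd hInt heq hl hx0
    obtain ⟨i2, e2⟩ := hpot x
    have hmono : ∫ y in {y : E | l < ‖y‖}, sphKer l x y *
        ((l / ‖y‖) ^ ((Module.finrank ℝ E : ℝ) + 4) * u (inv0 l y) ^ p - u y ^ p) ≤
        ∫ y in {y : E | l < ‖y‖}, (sphBad u l).indicator (fun y => p * B ^ (p - 1) * m *
          (‖x - y‖ ^ (-((Module.finrank ℝ E : ℝ) - 4)) * (l / ‖y‖) ^ 8)) y := by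
      refine setIntegral_mono_on_ae i1 ?_ hS ?_
      · exact ((integrable_indicator_iff hA).2 (i2.const_mul _)).integrableOn
      · have hne : ∀ᵐ y : E, y ≠ x := by simp [ae_iff]
        filter_upwards [hne] with y hyx hy
        have hy : l < ‖y‖ := hy
        have hy0 : 0 < ‖y‖ := hl.trans hy
        have hq : 0 < l / ‖y‖ := by positivity
        have hq1 : l / ‖y‖ ≤ 1 := (div_le_one hy0).2 hy.le
        have hk := sphKer_nonneg hd hl (Ne.symm hyx) hx hy.le
        have hk2 := sphKer_le l hl x y
        by_cases hw0 : 0 < sphDiff u l y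
        · rw [Set.indicator_of_mem (show y ∈ sphBad u l from ⟨hy, hw0⟩)]
          calc _ ≤ sphKer l x y * (p * B ^ (p - 1) * m * (l / ‖y‖) ^ 8) :=
                mul_le_mul_of_nonneg_left (sph_rhs_le hp hpd hq hq1 (hu0 _) (huB _) (hu0 _)
                  hw0 (hw y hy.le)) hk
            _ ≤ ‖x - y‖ ^ (-((Module.finrank ℝ E : ℝ) - 4)) *
                (p * B ^ (p - 1) * m * (l / ‖y‖) ^ 8) :=
                mul_le_mul_of_nonneg_right hk2 (by positivity)
            _ = _ := by ring
        · rw [Set.indicator_of_notMem (fun h => hw0 h.2)]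
          refine mul_nonpos_of_nonneg_of_nonpos hk
            (sph_rhs_nonpos hp hpd hq hq1 (hu0 _) (hu0 _) ?_)
          have := not_lt.1 hw0
          unfold sphDiff at this
          linarith
    rw [e1]
    calc _ ≤ κ * ∫ y in {y : E | l < ‖y‖}, (sphBad u l).indicator (fun y => p * B ^ (p - 1) * m *
          (‖x - y‖ ^ (-((Module.finrank ℝ E : ℝ) - 4)) * (l / ‖y‖) ^ 8)) y := by gcongr
      _ = κ * (p * B ^ (p - 1) * m * ∫ y in sphBad u l,
          ‖x - y‖ ^ (-((Module.finrank ℝ E : ℝ) - 4)) * (l / ‖y‖) ^ 8) := by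
        rw [setIntegral_indicator hA, Set.inter_eq_right.2 hAS, integral_const_mul]
      _ ≤ κ * (p * B ^ (p - 1) * m * ε) := by gcongr
      _ = (κ * (p * B ^ (p - 1)) * ε) * m := by ring
      _ ≤ 1 / 2 * m := by gcongr
      _ = m / 2 := by ring
  have hk : ∀ k : ℕ, ∀ x : E, l ≤ ‖x‖ → sphDiff u l x ≤ B * (1 / 2) ^ k := by
    intro k
    induction k with
    | zero =>
      intro x hx
      have hx0 : 0 < ‖x‖ := hl.trans_le hx
      have hq1 : (l / ‖x‖) ^ ((Module.finrank ℝ E : ℝ) - 4) ≤ 1 :=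
        Real.rpow_le_one (by positivity) ((div_le_one hx0).2 hx) (by linarith)
      have := hu0 x
      have h2 : (l / ‖x‖) ^ ((Module.finrank ℝ E : ℝ) - 4) * u (inv0 l x) ≤ 1 * B := by
        gcongr
        · exact hu0 _
        · exact huB _
      unfold sphDiff
      linarith
    | succ k ih =>
      intro x hx
      refine (step _ (by positivity) ih x hx).trans (le_of_eq ?_)
      ring
  intro x hx
  have hlim : Tendsto (fun k : ℕ => B * (1 / 2 : ℝ) ^ k) atTop (𝓝 (B * 0)) :=
    (tendsto_pow_atTop_nhds_zero_of_lt_one (by norm_num) (by norm_num)).const_mul B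
  rw [mul_zero] at hlim
  exact ge_of_tendsto' hlim fun k => hk k x hx

lemma continuousAt_sphDiff_radius (hd : 5 ≤ Module.finrank ℝ E) {u : E → ℝ} (hu : Continuous u)
    (x : E) : Continuous (fun l : ℝ => sphDiff u l x) := by
  have hγ : (5 : ℝ) ≤ Module.finrank ℝ E := by exact_mod_cast hd
  unfold sphDiff inv0
  have h1 : Continuous (fun l : ℝ => (l / ‖x‖) ^ ((Module.finrank ℝ E : ℝ) - 4)) :=
    (continuous_id.div_const _).rpow_const fun l => Or.inr (by linarith)
  have h2 : Continuous (fun l : ℝ => u ((l / ‖x‖) ^ 2 • x)) := hu.comp (by fun_prop)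
  exact (h1.mul h2).sub continuous_const

lemma sphDiff_neg (hd : 5 ≤ Module.finrank ℝ E) {p κ : ℝ} {u : E → ℝ}
    (hp : 1 < p) (hpd : ((Module.finrank ℝ E : ℝ) - 4) * p < Module.finrank ℝ E + 4)
    (hκ : 0 < κ) (hu0 : ∀ x, 0 < u x)
    (hInt : ∀ x, Integrable (fun y => ‖x - y‖ ^ (-((Module.finrank ℝ E : ℝ) - 4)) * u y ^ p))
    (heq : ∀ x, u x = κ * ∫ y, ‖x - y‖ ^ (-((Module.finrank ℝ E : ℝ) - 4)) * u y ^ p)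
    {l : ℝ} (hl : 0 < l) (hP : ∀ x : E, l ≤ ‖x‖ → sphDiff u l x ≤ 0) {x : E} (hx : l < ‖x‖) :
    sphDiff u l x < 0 := by
  have : Nontrivial E := Module.nontrivial_of_finrank_pos (R := ℝ) (by lia)
  have hx0 : x ≠ 0 := norm_pos_iff.1 (hl.trans hx)
  obtain ⟨i1, e1⟩ := sphDiff_eq_integral hd hInt heq hl hx0
  have hS : MeasurableSet {y : E | l < ‖y‖} := measurableSet_lt measurable_const measurable_norm
  have hneg : ∀ y : E, l < ‖y‖ → y ≠ x → sphKer l x y *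
      ((l / ‖y‖) ^ ((Module.finrank ℝ E : ℝ) + 4) * u (inv0 l y) ^ p - u y ^ p) < 0 := by
    intro y hy hyx
    have hy0 : 0 < ‖y‖ := hl.trans hy
    refine mul_neg_of_pos_of_neg (sphKer_pos hd hl (Ne.symm hyx) hx hy)
      (sph_rhs_neg hp hpd (by positivity) ((div_lt_one hy0).2 hy) (hu0 _).le (hu0 _) ?_)
    have := hP y hy.le
    unfold sphDiff at this
    linarith
  have hne : ∀ᵐ y : E, y ≠ x := by simp [ae_iff]
  have hpos : 0 < ∫ y in {y : E | l < ‖y‖}, -(sphKer l x y *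
      ((l / ‖y‖) ^ ((Module.finrank ℝ E : ℝ) + 4) * u (inv0 l y) ^ p - u y ^ p)) := by
    rw [setIntegral_pos_iff_support_of_nonneg_ae]
    · have hsub : ({y : E | l < ‖y‖} \ {x}) ⊆ (Function.support fun y => -(sphKer l x y *
          ((l / ‖y‖) ^ ((Module.finrank ℝ E : ℝ) + 4) * u (inv0 l y) ^ p - u y ^ p))) ∩
          {y : E | l < ‖y‖} := fun y hy => ⟨by
            have := hneg y hy.1 hy.2
            simp only [Function.mem_support]; linarith, hy.1⟩
      refine lt_of_lt_of_le ?_ (measure_mono hsub)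
      have hopen : IsOpen ({y : E | l < ‖y‖} \ {x}) :=
        (isOpen_lt continuous_const continuous_norm).sdiff isClosed_singleton
      refine hopen.measure_pos _ ⟨(2 : ℝ) • x, ?_, ?_⟩
      · change l < ‖(2 : ℝ) • x‖
        rw [norm_smul]; norm_num; linarith
      · intro h
        have h : (2 : ℝ) • x = x := h
        rw [two_smul, add_eq_left] at h
        exact hx0 h
    · refine (ae_restrict_iff' hS).2 ?_
      filter_upwards [hne] with y hyx hy
      have := hneg y hy hyx
      simp only [Pi.zero_apply]; linarith
    · exact i1.neg
  rw [integral_neg] at hpos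
  rw [e1]
  exact mul_neg_of_pos_of_neg hκ (by linarith)

lemma tendsto_volume_sphBad (hd : 5 ≤ Module.finrank ℝ E) {u : E → ℝ} (hu : Continuous u)
    {l₀ : ℝ} (hneg : ∀ x : E, l₀ < ‖x‖ → sphDiff u l₀ x < 0) (T : ℝ) :
    Tendsto (fun l => volume.real (sphBad u l ∩ closedBall 0 T)) (𝓝[≥] l₀) (𝓝 0) := by
  have : Nontrivial E := Module.nontrivial_of_finrank_pos (R := ℝ) (by lia)
  have e : ∀ l, volume.real (sphBad u l ∩ closedBall 0 T) =
      ∫ y in closedBall (0 : E) T, (sphBad u l).indicator (fun _ => (1 : ℝ)) y := fun l => by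
    rw [setIntegral_indicator (measurableSet_sphBad hu l), setIntegral_const, smul_eq_mul, mul_one,
      Set.inter_comm]
  simp only [e]
  have h0 : (0 : ℝ) = ∫ y in closedBall (0 : E) T, (0 : ℝ) := by simp
  rw [h0]
  refine tendsto_integral_filter_of_dominated_convergence (fun _ => (1 : ℝ)) ?_ ?_ ?_ ?_
  · exact Eventually.of_forall fun l =>
      (measurable_const.indicator (measurableSet_sphBad hu l)).aestronglyMeasurable
  · refine Eventually.of_forall fun l => Eventually.of_forall fun y => ?_
    refine (norm_indicator_le_norm_self _ _).trans (by simp)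
  · exact integrableOn_const measure_closedBall_lt_top.ne
  · have hsph : ∀ᵐ y : E, ‖y‖ ≠ l₀ := by
      have := Measure.addHaar_sphere (volume : Measure E) 0 l₀
      rw [ae_iff]
      convert this using 2
      ext; simp
    refine ae_restrict_of_ae ?_
    filter_upwards [hsph] with y hy
    refine tendsto_const_nhds.congr' ?_
    rcases lt_or_gt_of_ne hy with h | h
    · filter_upwards [self_mem_nhdsWithin] with l hl
      rw [Set.indicator_of_notMem]
      exact fun h' => absurd h'.1 (not_lt.2 (h.le.trans hl))
    · have h2 : ∀ᶠ l in 𝓝 l₀, sphDiff u l y < 0 :=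
        (continuousAt_sphDiff_radius hd hu y).continuousAt.eventually_lt
          continuousAt_const (hneg y h)
      filter_upwards [nhdsWithin_le_nhds h2] with l hl
      rw [Set.indicator_of_notMem]
      exact fun h' => absurd h'.2 hl.not_gt

lemma sphDiff_nonpos (hd : 5 ≤ Module.finrank ℝ E) {p κ B : ℝ} {u : E → ℝ}
    (hp : 1 < p) (hpd : ((Module.finrank ℝ E : ℝ) - 4) * p < Module.finrank ℝ E + 4)
    (hκ : 0 < κ) (hu : Continuous u) (hu0 : ∀ x, 0 < u x) (huB : ∀ x, u x ≤ B)
    (hInt : ∀ x, Integrable (fun y => ‖x - y‖ ^ (-((Module.finrank ℝ E : ℝ) - 4)) * u y ^ p))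
    (heq : ∀ x, u x = κ * ∫ y, ‖x - y‖ ^ (-((Module.finrank ℝ E : ℝ) - 4)) * u y ^ p)
    {l : ℝ} (hl : 0 < l) : ∀ x : E, l ≤ ‖x‖ → sphDiff u l x ≤ 0 := by
  have hB : 0 < B := (hu0 0).trans_le (huB 0)
  set K := κ * (p * B ^ (p - 1)) with hK
  have hK0 : 0 < K := by positivity
  have hu0' : ∀ x, 0 ≤ u x := fun x => (hu0 x).le
  have hsmall := fun {l : ℝ} (hl : 0 < l) => sphDiff_nonpos_of_potential_small hd hp hpd hκ.le hu
    hu0' huB hInt heq (ε := 1 / (2 * K)) hl (by rw [← hK]; field_simp; exact le_rfl)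
  -- small radii
  obtain ⟨a, ha, hstart⟩ : ∃ a : ℝ, 0 < a ∧ ∀ l, 0 < l → l < a →
      ∀ x : E, l ≤ ‖x‖ → sphDiff u l x ≤ 0 := by
    have hM := potMass_nonneg (E := E)
    set M := potMass E
    refine ⟨min 1 (1 / (16 * (M + 1) * K)), by positivity, fun l hl hla => hsmall hl fun x => ?_⟩
    have hl1 : l ≤ 1 := hla.le.trans (min_le_left _ _)
    have hl2 : l ≤ 1 / (16 * (M + 1) * K) := hla.le.trans (min_le_right _ _)
    obtain ⟨h1, h2⟩ := potential_small_radius hd hl hl1 (measurableSet_sphBad hu l)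
      (fun y hy => hy.1) x
    refine ⟨h1, h2.trans ?_⟩
    calc 8 * l ^ 3 * M ≤ 8 * l ^ 1 * (M + 1) := by
          gcongr 8 * ?_ * ?_
          · exact pow_le_pow_of_le_one hl.le hl1 (by norm_num)
          · linarith
      _ ≤ 8 * (1 / (16 * (M + 1) * K)) * (M + 1) := by rw [pow_one]; gcongr
      _ = _ := by field_simp; norm_num
  by_contra hcon
  set S : Set ℝ := {l | 0 < l ∧ ¬ ∀ x : E, l ≤ ‖x‖ → sphDiff u l x ≤ 0} with hSd
  have hSne : S.Nonempty := ⟨l, hl, hcon⟩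
  have hSb : BddBelow S := ⟨0, fun l hl => hl.1.le⟩
  have hSa : a ≤ sInf S := le_csInf hSne fun l hl => by
    by_contra h
    exact hl.2 (hstart l hl.1 (not_le.1 h))
  set l₁ := sInf S with hl₁
  have hl₁0 : 0 < l₁ := ha.trans_le hSa
  have hlt : ∀ l, 0 < l → l < l₁ → ∀ x : E, l ≤ ‖x‖ → sphDiff u l x ≤ 0 := fun l h0 h => by
    by_contra h'
    exact absurd (csInf_le hSb (show l ∈ S from ⟨h0, h'⟩)) (not_le.2 h)
  have hP : ∀ x : E, l₁ ≤ ‖x‖ → sphDiff u l₁ x ≤ 0 := fun x hx => by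
    have h1 : Tendsto (fun l => sphDiff u l x) (𝓝[<] l₁) (𝓝 (sphDiff u l₁ x)) :=
      ((continuousAt_sphDiff_radius hd hu x).tendsto l₁).mono_left nhdsWithin_le_nhds
    refine le_of_tendsto h1 ?_
    filter_upwards [Ioo_mem_nhdsLT hl₁0] with l hl
    exact hlt l hl.1 hl.2 x (hl.2.le.trans hx)
  have hneg := fun {x : E} (hx : l₁ < ‖x‖) => sphDiff_neg hd hp hpd hκ hu0 hInt heq hl₁0 hP hx
  obtain ⟨T, η, hη, hT⟩ := potential_small_set (E := E) hd (L := l₁ + 1) (ε := 1 / (2 * K))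
    (by positivity) (by positivity)
  have hev : ∀ᶠ l in 𝓝[≥] l₁, ∀ x : E, l ≤ ‖x‖ → sphDiff u l x ≤ 0 := by
    have h1 := (tendsto_volume_sphBad hd hu (fun x => hneg) T).eventually_le_const hη
    filter_upwards [h1, self_mem_nhdsWithin, nhdsWithin_le_nhds (Iio_mem_nhds (lt_add_one l₁))]
      with l hl1 hl2 hl3
    have hl0 : 0 < l := hl₁0.trans_le hl2
    exact hsmall hl0 fun x => hT l _ hl0 (le_of_lt hl3) (measurableSet_sphBad hu l)
      (fun y hy => hy.1) hl1 x
  obtain ⟨b, hb, hbs⟩ := mem_nhdsGE_iff_exists_Ico_subset.1 hev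
  obtain ⟨l, hlS, hlb⟩ := exists_lt_of_csInf_lt hSne (show sInf S < b from hb)
  exact hlS.2 (hbs ⟨csInf_le hSb hlS, hlb⟩)

/-- Liouville theorem for the subcritical integral equation. -/
theorem liouville_integral (hd : 5 ≤ Module.finrank ℝ E) {p κ B : ℝ} {u : E → ℝ}
    (hp : 1 < p) (hpd : ((Module.finrank ℝ E : ℝ) - 4) * p < Module.finrank ℝ E + 4)
    (hκ : 0 < κ) (hu : Continuous u) (hu0 : ∀ x, 0 ≤ u x) (huB : ∀ x, u x ≤ B)
    (hInt : ∀ x, Integrable (fun y => ‖x - y‖ ^ (-((Module.finrank ℝ E : ℝ) - 4)) * u y ^ p))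
    (heq : ∀ x, u x = κ * ∫ y, ‖x - y‖ ^ (-((Module.finrank ℝ E : ℝ) - 4)) * u y ^ p) :
    ∀ x, u x = 0 := by
  have : Nontrivial E := Module.nontrivial_of_finrank_pos (R := ℝ) (by lia)
  have hγ : (5 : ℝ) ≤ Module.finrank ℝ E := by exact_mod_cast hd
  by_contra hne
  push Not at hne
  obtain ⟨z₀, hz₀⟩ := hne
  have hpos : ∀ x, 0 < u x := by
    intro x
    rw [heq x]
    refine mul_pos hκ ?_
    rw [integral_pos_iff_support_of_nonneg (fun y => by have := hu0 y; positivity) (hInt x)]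
    have hopen : IsOpen ({y | 0 < u y} \ {x}) :=
      (isOpen_lt continuous_const hu).sdiff isClosed_singleton
    have hz : 0 < u z₀ := lt_of_le_of_ne (hu0 _) (Ne.symm hz₀)
    have hne : ({y | 0 < u y} \ {x}).Nonempty := by
      by_contra hcon
      rw [Set.not_nonempty_iff_eq_empty, Set.sdiff_eq_empty] at hcon
      have hfin : ({y | 0 < u y} : Set E).Finite := (Set.finite_singleton x).subset hcon
      have h0 := hfin.measure_zero (volume : Measure E)
      exact ((isOpen_lt continuous_const hu).measure_pos volume ⟨z₀, hz⟩).ne' h0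
    refine (hopen.measure_pos volume hne).trans_le (measure_mono fun y hy => ?_)
    have h1 : 0 < u y := hy.1
    have h2 : 0 < ‖x - y‖ := norm_pos_iff.2 (sub_ne_zero.2 (Ne.symm hy.2))
    exact (by positivity : 0 < ‖x - y‖ ^ (-((Module.finrank ℝ E : ℝ) - 4)) * u y ^ p).ne'
  have hall : ∀ (c : E) (l : ℝ), 0 < l → ∀ x : E, l ≤ ‖x‖ →
      sphDiff (fun y => u (c + y)) l x ≤ 0 := by
    intro c l hl
    refine sphDiff_nonpos (u := fun y => u (c + y)) hd hp hpd hκ (B := B)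
      (hu.comp (continuous_const_add c)) (fun x => hpos _)
      (fun x => huB _) (fun x => ?_) (fun x => ?_) hl
    · have := (hInt (c + x)).comp_add_left c
      simpa using this
    · have h2 := integral_add_left_eq_self (μ := (volume : Measure E))
        (fun y => ‖c + x - y‖ ^ (-((Module.finrank ℝ E : ℝ) - 4)) * u y ^ p) c
      rw [show u (c + x) = _ from heq (c + x), ← h2]
      simp
  have hle : ∀ y z, u y ≤ u z := by
    intro y z
    rcases eq_or_ne y z with rfl | hyz
    · exact le_rfl
    have hD : 0 < ‖z - y‖ := norm_pos_iff.2 (sub_ne_zero.2 (Ne.symm hyz))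
    have key : ∀ t : ℝ, 0 < t →
        (√(t * (1 + t)) / (1 + t)) ^ ((Module.finrank ℝ E : ℝ) - 4) * u y ≤ u z := by
      intro t ht
      have hn : ‖(1 + t) • (z - y)‖ = (1 + t) * ‖z - y‖ := by
        rw [norm_smul, Real.norm_of_nonneg (by positivity)]
      have hs : √(t * (1 + t)) ≤ 1 + t := Real.sqrt_le_iff.2 ⟨by positivity, by nlinarith⟩
      have h := hall (y - t • (z - y)) (√(t * (1 + t)) * ‖z - y‖) (by positivity)
        ((1 + t) • (z - y)) (by rw [hn]; gcongr)
      have e1 : √(t * (1 + t)) * ‖z - y‖ / ((1 + t) * ‖z - y‖) = √(t * (1 + t)) / (1 + t) := by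
        field_simp
      have e2 : (√(t * (1 + t)) / (1 + t)) ^ 2 * (1 + t) = t := by
        rw [div_pow, Real.sq_sqrt (by positivity)]; field_simp
      unfold sphDiff inv0 at h
      rw [hn, e1, smul_smul, e2] at h
      beta_reduce at h
      rw [sub_add_cancel, add_smul, one_smul] at h
      have e3 : y - t • (z - y) + (z - y + t • (z - y)) = z := by abel
      rw [e3] at h
      linarith
    have hlim : Tendsto (fun t : ℝ => (√(t * (1 + t)) / (1 + t)) ^
        ((Module.finrank ℝ E : ℝ) - 4) * u y) atTop
        (𝓝 ((√ 1) ^ ((Module.finrank ℝ E : ℝ) - 4) * u y)) := by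
      have h1 : Tendsto (fun t : ℝ => 1 - (1 + t)⁻¹) atTop (𝓝 (1 - 0)) :=
        tendsto_const_nhds.sub (tendsto_inv_atTop_zero.comp
          (tendsto_atTop_add_const_left _ _ tendsto_id))
      rw [sub_zero] at h1
      have h2 : Tendsto (fun t : ℝ => √(t * (1 + t)) / (1 + t)) atTop (𝓝 (√ 1)) := by
        refine (h1.sqrt).congr' ?_
        filter_upwards [eventually_gt_atTop 0] with t ht
        have : 1 - (1 + t)⁻¹ = t * (1 + t) / (1 + t) ^ 2 := by field_simp; ring
        rw [this, Real.sqrt_div (by positivity), Real.sqrt_sq (by positivity)]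
      exact (h2.rpow_const (Or.inr (by linarith))).mul_const _
    rw [Real.sqrt_one, Real.one_rpow, one_mul] at hlim
    refine le_of_tendsto hlim ?_
    filter_upwards [eventually_gt_atTop 0] with t ht using key t ht
  have hconst : ∀ y, u y = u 0 := fun y => le_antisymm (hle _ _) (hle _ _)
  have hI := hInt 0
  have h0 : 0 < u 0 ^ p := by have := hpos 0; positivity
  refine not_integrable_norm_rpow hd ((hI.mul_const (u 0 ^ p)⁻¹).congr
    (Eventually.of_forall fun y => ?_))
  simp only [zero_sub, norm_neg, hconst y]
  field_simp

end MovingSpheres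

section DirectionalDerivatives

open Topology
open scoped ContDiff

variable {V : Type*} [NormedAddCommGroup V] [NormedSpace ℝ V]

/-- The derivative of `f` in the direction `e`. -/
noncomputable def dd (e : V) (f : V → ℝ) : V → ℝ := fun x => fderiv ℝ f x e

/-- Iterated directional derivatives. -/
noncomputable def ddl (l : List V) (f : V → ℝ) : V → ℝ := l.foldr dd f

/-- The sum of the second derivatives along a family of directions. -/
noncomputable def dlap {ι : Type*} [Fintype ι] (b : ι → V) (f : V → ℝ) : V → ℝ :=
  fun x => ∑ i, dd (b i) (dd (b i) f) x

@[simp] lemma ddl_nil (f : V → ℝ) : ddl [] f = f := rfl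

@[simp] lemma ddl_cons (e : V) (l : List V) (f : V → ℝ) : ddl (e :: l) f = dd e (ddl l f) := rfl

lemma ContDiffOn.dd {m k : ℕ∞ω} {f : V → ℝ} {U : Set V} (hf : ContDiffOn ℝ k f U)
    (hU : IsOpen U) (h : m + 1 ≤ k) (e : V) : ContDiffOn ℝ m (_root_.dd e f) U :=
  (hf.fderiv_of_isOpen hU h).clm_apply contDiffOn_const

lemma ContDiffOn.ddl {f : V → ℝ} {U : Set V} (hU : IsOpen U) (l : List V) {m : ℕ∞ω}
    (hf : ContDiffOn ℝ (m + l.length) f U) : ContDiffOn ℝ m (_root_.ddl l f) U := by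
  induction l generalizing m with
  | nil => simpa using hf
  | cons e l ih =>
    refine ContDiffOn.dd (ih (m := m + 1) ?_) hU le_rfl e
    simpa [add_assoc, add_comm (1 : ℕ∞ω)] using hf

lemma ContDiffOn.dlap {ι : Type*} [Fintype ι] {m : ℕ∞ω} {f : V → ℝ} {U : Set V} (b : ι → V)
    (hf : ContDiffOn ℝ (m + 2) f U) (hU : IsOpen U) : ContDiffOn ℝ m (_root_.dlap b f) U :=
  ContDiffOn.sum fun i _ => (hf.dd (m := m + 1) hU (by rw [add_assoc, one_add_one_eq_two]) _).dd hU
    le_rfl _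

lemma natCast_le_infty (k : ℕ) : (k : ℕ∞ω) ≤ ∞ := WithTop.coe_le_coe.2 (le_top : (k : ℕ∞) ≤ ⊤)

lemma infty_add_natCast (k : ℕ) : (∞ : ℕ∞ω) + k = ∞ := by
  change (((⊤ : ℕ∞) : ℕ∞ω)) + (((k : ℕ∞)) : ℕ∞ω) = _
  rw [← WithTop.coe_add, top_add]

lemma ContDiffOn.ddl_infty {f : V → ℝ} {U : Set V} (hf : ContDiffOn ℝ ∞ f U) (hU : IsOpen U)
    (l : List V) : ContDiffOn ℝ ∞ (_root_.ddl l f) U :=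
  ContDiffOn.ddl hU l (by rwa [infty_add_natCast])

lemma ContDiffOn.dlap_infty {ι : Type*} [Fintype ι] {f : V → ℝ} {U : Set V} (b : ι → V)
    (hf : ContDiffOn ℝ ∞ f U) (hU : IsOpen U) : ContDiffOn ℝ ∞ (_root_.dlap b f) U :=
  ContDiffOn.dlap b (by rwa [show (2 : ℕ∞ω) = ((2 : ℕ) : ℕ∞ω) from rfl, infty_add_natCast]) hU

lemma ContDiff.ddl_infty {f : V → ℝ} (hf : ContDiff ℝ ∞ f) (l : List V) :
    ContDiff ℝ ∞ (_root_.ddl l f) :=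
  contDiffOn_univ.1 (hf.contDiffOn.ddl_infty isOpen_univ l)

lemma ContDiff.dlap_infty {ι : Type*} [Fintype ι] {f : V → ℝ} (b : ι → V)
    (hf : ContDiff ℝ ∞ f) : ContDiff ℝ ∞ (_root_.dlap b f) :=
  contDiffOn_univ.1 (hf.contDiffOn.dlap_infty b isOpen_univ)

lemma Filter.EventuallyEq.dd {f g : V → ℝ} {x : V} (h : f =ᶠ[𝓝 x] g) (e : V) :
    _root_.dd e f =ᶠ[𝓝 x] _root_.dd e g := h.fderiv.fun_comp fun L : V →L[ℝ] ℝ => L e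

lemma Filter.EventuallyEq.ddl {f g : V → ℝ} {x : V} (h : f =ᶠ[𝓝 x] g) (l : List V) :
    _root_.ddl l f =ᶠ[𝓝 x] _root_.ddl l g := by
  induction l with
  | nil => exact h
  | cons e l ih => exact ih.dd e

lemma Filter.EventuallyEq.dlap {ι : Type*} [Fintype ι] (b : ι → V) {f g : V → ℝ} {x : V}
    (h : f =ᶠ[𝓝 x] g) : _root_.dlap b f =ᶠ[𝓝 x] _root_.dlap b g := by
  filter_upwards [eventually_all.2 fun i => h.ddl [b i, b i]] with y hy
  exact Finset.sum_congr rfl fun i _ => hy i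

lemma tsupport_ddl_subset (l : List V) (f : V → ℝ) : tsupport (ddl l f) ⊆ tsupport f := by
  induction l with
  | nil => exact subset_rfl
  | cons e l ih => exact (tsupport_fderiv_apply_subset ℝ e).trans ih

lemma tsupport_dlap_subset {ι : Type*} [Fintype ι] (b : ι → V) (f : V → ℝ) :
    tsupport (dlap b f) ⊆ tsupport f := by
  refine closure_minimal (fun x hx => ?_) (isClosed_tsupport f)
  by_contra h
  refine hx (Finset.sum_eq_zero fun i _ => ?_)
  exact image_eq_zero_of_notMem_tsupport fun h' => h (tsupport_ddl_subset [b i, b i] f h')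

lemma ddl_zero (l : List V) : ddl l (fun _ => (0 : ℝ)) = fun _ => 0 := by
  induction l with
  | nil => rfl
  | cons e l ih => rw [ddl_cons, ih]; ext x; simp [dd]

lemma dd_comm {f : V → ℝ} (hf : ContDiff ℝ 2 f) (a b : V) : dd a (dd b f) = dd b (dd a f) := by
  ext x
  have h : ∀ c d : V, dd c (dd d f) x = fderiv ℝ (fderiv ℝ f) x c d := fun c d => by
    have h1 : DifferentiableAt ℝ (fderiv ℝ f) x :=
      (hf.fderiv_right (m := 1) (by norm_num)).differentiable one_ne_zero x
    change fderiv ℝ (fun y => fderiv ℝ f y d) x c = _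
    rw [fderiv_clm_apply h1 (differentiableAt_const d)]
    simp
  rw [h, h]
  exact (hf.contDiffAt.isSymmSndFDerivAt (by simp)) a b

lemma dd_sum {ι : Type*} [Fintype ι] {F : ι → V → ℝ} (hF : ∀ i, ContDiff ℝ 1 (F i)) (a : V) :
    dd a (fun x => ∑ i, F i x) = fun x => ∑ i, dd a (F i) x := by
  ext x
  rw [dd, fderiv_fun_sum fun i _ => (hF i).differentiable one_ne_zero x]
  simp [dd]

lemma dd_dlap {ι : Type*} [Fintype ι] {f : V → ℝ} (b : ι → V) (hf : ContDiff ℝ ∞ f) (a : V) :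
    dd a (dlap b f) = dlap b (dd a f) := by
  have h : ∀ l : List V, ContDiff ℝ ∞ (ddl l f) := hf.ddl_infty
  unfold dlap
  rw [dd_sum (F := fun i => dd (b i) (dd (b i) f)) fun i => (h [b i, b i]).of_le (by simp)]
  ext x
  refine Finset.sum_congr rfl fun i _ => ?_
  rw [dd_comm (f := dd (b i) f) ((h [b i]).of_le (natCast_le_infty 2)) a (b i),
    dd_comm (hf.of_le (natCast_le_infty 2)) a (b i)]

lemma ddl_dlap {ι : Type*} [Fintype ι] {f : V → ℝ} (b : ι → V) (hf : ContDiff ℝ ∞ f)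
    (l : List V) : ddl l (dlap b f) = dlap b (ddl l f) := by
  induction l with
  | nil => rfl
  | cons e l ih => rw [ddl_cons, ih, dd_dlap b (hf.ddl_infty l), ddl_cons]

end DirectionalDerivatives

section IntegrationByParts

open Topology
open scoped ContDiff

variable {E : Type*} [NormedAddCommGroup E] [InnerProductSpace ℝ E] [FiniteDimensional ℝ E]
  [MeasurableSpace E] [BorelSpace E]

lemma integrable_mul_of_tsupport {φ v : E → ℝ} {U : Set E} (hφ : Continuous φ)
    (hc : HasCompactSupport φ) (hU : IsOpen U) (hs : tsupport φ ⊆ U) (hv : ContinuousOn v U) :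
    Integrable (fun x => φ x * v x) := by
  have h1 : Continuous fun x => φ x * v x := by
    rw [continuous_iff_continuousAt]
    intro x
    by_cases hx : x ∈ tsupport φ
    · exact hφ.continuousAt.mul (hv.continuousAt (hU.mem_nhds (hs hx)))
    · have : (fun x => φ x * v x) =ᶠ[𝓝 x] fun _ => 0 := by
        filter_upwards [(isClosed_tsupport φ).isOpen_compl.mem_nhds hx] with y hy
        rw [image_eq_zero_of_notMem_tsupport hy, zero_mul]
      exact this.continuousAt
  exact h1.integrable_of_hasCompactSupport hc.mul_right

lemma integral_dd_mul {φ v : E → ℝ} {U : Set E} (hφ : ContDiff ℝ 1 φ)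
    (hc : HasCompactSupport φ) (hU : IsOpen U) (hs : tsupport φ ⊆ U) (hv : ContDiffOn ℝ 1 v U)
    (e : E) : ∫ x, dd e φ x * v x = -∫ x, φ x * dd e v x := by
  have hv' : ContinuousOn (dd e v) U :=
    (hv.dd (m := 0) hU (by norm_num) e).continuousOn
  have hφ' : Continuous (dd e φ) := (hφ.continuous_fderiv one_ne_zero).clm_apply continuous_const
  have hs' : tsupport (dd e φ) ⊆ tsupport φ := tsupport_ddl_subset [e] φ
  have hvd : ∀ x ∈ U, HasLineDerivAt ℝ v (dd e v x) x e := fun x hx =>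
    (((hv.contDiffAt (hU.mem_nhds hx)).differentiableAt one_ne_zero).hasFDerivAt).hasLineDerivAt e
  have h0 := integrable_mul_of_tsupport hφ' (hc.of_isClosed_subset (isClosed_tsupport _) hs')
    hU (hs'.trans hs) hv.continuousOn
  have := integral_bilinear_hasLineDerivAt_right_eq_neg_left_of_integrable (μ := volume)
    (f := φ) (f' := dd e φ) (g := v) (g' := dd e v) (v := e) (B := ContinuousLinearMap.mul ℝ ℝ)
    (by simpa using h0)
    (by simpa using integrable_mul_of_tsupport hφ.continuous hc hU hs hv')
    (by simpa using integrable_mul_of_tsupport hφ.continuous hc hU hs hv.continuousOn)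
    (fun x _ => (hφ.differentiable one_ne_zero x).hasFDerivAt.hasLineDerivAt e)
    (fun x hx => hvd x (hs hx))
  simp only [ContinuousLinearMap.mul_apply'] at this
  rw [this, neg_neg]

lemma abs_integral_ddl_mul {φ v : E → ℝ} {U : Set E} (hφ : ContDiff ℝ ∞ φ)
    (hc : HasCompactSupport φ) (hU : IsOpen U) (hs : tsupport φ ⊆ U) (l : List E)
    (hv : ContDiffOn ℝ l.length v U) :
    |∫ x, ddl l φ x * v x| = |∫ x, φ x * ddl l.reverse v x| := by
  induction l generalizing v with
  | nil => rfl
  | cons e l ih =>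
    have hs' := tsupport_ddl_subset l φ
    have hv1 : ContDiffOn ℝ 1 v U := hv.of_le (by simp)
    rw [ddl_cons, integral_dd_mul ((hφ.ddl_infty l).of_le (by simp))
      (hc.of_isClosed_subset (isClosed_tsupport _) hs') hU (hs'.trans hs) hv1, abs_neg,
      ih (hv.dd hU (by simp) e)]
    simp [ddl]

lemma integral_dlap_mul {ι : Type*} [Fintype ι] (b : ι → E) {φ v : E → ℝ} {U : Set E}
    (hφ : ContDiff ℝ ∞ φ) (hc : HasCompactSupport φ) (hU : IsOpen U) (hs : tsupport φ ⊆ U)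
    (hv : ContDiffOn ℝ 2 v U) :
    ∫ x, dlap b φ x * v x = ∫ x, φ x * dlap b v x := by
  have hs' := fun l => (tsupport_ddl_subset l φ).trans hs
  have hc' := fun l => hc.of_isClosed_subset (isClosed_tsupport _) (tsupport_ddl_subset l φ)
  have hφ' := fun l => hφ.ddl_infty l
  have hv1 : ∀ i, ContDiffOn ℝ 1 (dd (b i) v) U := fun i => hv.dd hU (by norm_num) _
  have hv2 : ∀ i, ContDiffOn ℝ 0 (dd (b i) (dd (b i) v)) U := fun i =>
    (hv1 i).dd hU (by norm_num) _
  simp only [dlap, Finset.sum_mul, Finset.mul_sum]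
  rw [integral_finsetSum _ fun i _ => ?_, integral_finsetSum _ fun i _ => ?_]
  · refine Finset.sum_congr rfl fun i _ => ?_
    have h := integral_dd_mul ((hφ' [b i]).of_le (by simp)) (hc' [b i]) hU (hs' [b i])
      (hv.of_le (by norm_num)) (b i)
    simp only [ddl_cons, ddl_nil] at h
    rw [h, integral_dd_mul (hφ.of_le (by simp)) hc hU hs (hv1 i), neg_neg]
  · exact integrable_mul_of_tsupport hφ.continuous hc hU hs (hv2 i).continuousOn
  · exact integrable_mul_of_tsupport (hφ' [b i, b i]).continuous (hc' [b i, b i]) hU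
      (hs' [b i, b i]) hv.continuousOn

lemma integral_dlap_dlap_mul {ι : Type*} [Fintype ι] (b : ι → E) {φ v : E → ℝ} {U : Set E}
    (hφ : ContDiff ℝ ∞ φ) (hc : HasCompactSupport φ) (hU : IsOpen U) (hs : tsupport φ ⊆ U)
    (hv : ContDiffOn ℝ 4 v U) :
    ∫ x, dlap b (dlap b φ) x * v x = ∫ x, φ x * dlap b (dlap b v) x := by
  have hs' := tsupport_dlap_subset b φ
  rw [integral_dlap_mul b (hφ.dlap_infty b) (hc.of_isClosed_subset (isClosed_tsupport _) hs') hU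
    (hs'.trans hs) (hv.of_le (by norm_num)), integral_dlap_mul b hφ hc hU hs
    (ContDiffOn.dlap b (hv.of_le (by norm_num)) hU)]

end IntegrationByParts

section Homogeneous

open Topology
open scoped ContDiff

variable {V : Type*} [NormedAddCommGroup V] [NormedSpace ℝ V]

/-- Positive homogeneity of degree `m`. -/
def PosHomog (m : ℝ) (f : V → ℝ) : Prop := ∀ t : ℝ, 0 < t → ∀ z, f (t • z) = t ^ m * f z

lemma PosHomog.dd {m : ℝ} {f : V → ℝ} (hf : PosHomog m f) (e : V) :
    PosHomog (m - 1) (dd e f) := by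
  intro t ht z
  have h1 := fderiv_comp_smul (𝕜 := ℝ) (f := f) (x := z) t
  have h2 : (fun z => f (t • z)) = t ^ m • f := by
    ext z; simp [hf t ht z]
  rw [h2, fderiv_const_smul_field] at h1
  have h3 := congrArg (fun L : V →L[ℝ] ℝ => L e) h1
  simp only [smul_apply, smul_eq_mul] at h3
  rw [Real.rpow_sub_one ht.ne']
  simp only [_root_.dd]
  field_simp
  simpa [mul_comm] using h3.symm

lemma PosHomog.ddl {m : ℝ} {f : V → ℝ} (hf : PosHomog m f) (l : List V) :
    PosHomog (m - l.length) (ddl l f) := by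
  induction l with
  | nil => simpa using hf
  | cons e l ih =>
    have := ih.dd e
    rw [sub_sub] at this
    simpa using this

lemma PosHomog.exists_bound [FiniteDimensional ℝ V] {m : ℝ} {f : V → ℝ} (hf : PosHomog m f)
    (hc : ContinuousOn f {z | z ≠ 0}) : ∃ C, 0 ≤ C ∧ ∀ z, z ≠ 0 → |f z| ≤ C * ‖z‖ ^ m := by
  have : ProperSpace V := FiniteDimensional.proper ℝ V
  obtain ⟨C, hC⟩ := (isCompact_sphere (0 : V) 1).exists_bound_of_continuousOn
    (hc.mono fun z hz h => by simp [h] at hz)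
  refine ⟨max C 0, le_max_right _ _, fun z hz => ?_⟩
  have hz' : 0 < ‖z‖ := norm_pos_iff.2 hz
  have h1 := hf ‖z‖ hz' (‖z‖⁻¹ • z)
  rw [smul_smul, mul_inv_cancel₀ hz'.ne', one_smul] at h1
  rw [h1, abs_mul, abs_of_pos (by positivity), mul_comm]
  gcongr
  refine (hC _ ?_).trans (le_max_left _ _)
  simp [norm_smul, hz'.ne']

end Homogeneous

section RegularizedKernel

open Topology
open scoped ContDiff

variable {E : Type*} [NormedAddCommGroup E] [InnerProductSpace ℝ E]

/-- Regularized powers of the norm, as functions on `ℝ × E`. -/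
noncomputable def regKer (q : ℝ) : ℝ × E → ℝ := fun z => (‖z.2‖ ^ 2 + z.1 ^ 2) ^ q

lemma regKer_base_pos {z : ℝ × E} (hz : z ≠ 0) : 0 < ‖z.2‖ ^ 2 + z.1 ^ 2 := by
  by_contra h
  have h1 := sq_nonneg ‖z.2‖
  have h2 := sq_nonneg z.1
  refine hz (Prod.ext ?_ ?_)
  · exact pow_eq_zero_iff two_ne_zero |>.1 (by linarith)
  · exact norm_eq_zero.1 (pow_eq_zero_iff two_ne_zero |>.1 (by linarith))

lemma isOpen_ne_zero {V : Type*} [NormedAddCommGroup V] : IsOpen {z : V | z ≠ 0} :=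
  isOpen_compl_singleton

lemma contDiffOn_regKer (q : ℝ) : ContDiffOn ℝ ∞ (regKer q : ℝ × E → ℝ) {z | z ≠ 0} := by
  intro z hz
  have h1 : ContDiff ℝ ∞ fun z : ℝ × E => ‖z.2‖ ^ 2 + z.1 ^ 2 :=
    (contDiff_snd.norm_sq ℝ).add (contDiff_fst.pow 2)
  exact (h1.contDiffAt.rpow_const_of_ne (regKer_base_pos hz).ne').contDiffWithinAt

lemma regKer_posHomog (q : ℝ) : PosHomog (2 * q) (regKer q : ℝ × E → ℝ) := by
  intro t ht z
  have : ‖(t • z).2‖ ^ 2 + (t • z).1 ^ 2 = t ^ 2 * (‖z.2‖ ^ 2 + z.1 ^ 2) := by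
    simp [norm_smul, mul_pow]; ring
  rw [regKer, this, Real.mul_rpow (by positivity) (by positivity), regKer,
    ← Real.rpow_natCast t 2, ← Real.rpow_mul ht.le]
  norm_num

lemma regKer_eq_mul {q : ℝ} {z : ℝ × E} (hz : z ≠ 0) :
    regKer q z = regKer (q - 1) z * (‖z.2‖ ^ 2 + z.1 ^ 2) := by
  rw [regKer, regKer, ← Real.rpow_add_one (regKer_base_pos hz).ne', sub_add_cancel]

lemma dd_regKer (q : ℝ) (e : E) {z : ℝ × E} (hz : z ≠ 0) :
    dd ((0 : ℝ), e) (regKer q) z = 2 * q * inner ℝ z.2 e * regKer (q - 1) z := by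
  have h1 : HasFDerivAt (fun z : ℝ × E => ‖z.2‖ ^ 2 + z.1 ^ 2) _ z :=
    (hasFDerivAt_snd.norm_sq).add (hasFDerivAt_fst.pow 2)
  have h2 := h1.rpow_const (p := q) (Or.inl (regKer_base_pos hz).ne')
  have h3 : fderiv ℝ (regKer q) z = _ := h2.fderiv
  rw [dd, h3]
  simp [regKer]
  ring

lemma dd_inner_mul {g : ℝ × E → ℝ} {z : ℝ × E} (hg : DifferentiableAt ℝ g z) (c : ℝ) (e : E) :
    dd ((0 : ℝ), e) (fun z => c * inner ℝ z.2 e * g z) z =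
      c * ‖e‖ ^ 2 * g z + c * inner ℝ z.2 e * dd ((0 : ℝ), e) g z := by
  have h1 : HasFDerivAt (fun z : ℝ × E => inner ℝ z.2 e) _ z :=
    hasFDerivAt_snd.inner ℝ (hasFDerivAt_const e z)
  have h2 := ((h1.const_mul c).mul hg.hasFDerivAt).fderiv
  change fderiv ℝ _ z _ = _
  erw [h2]
  simp [dd]
  ring

lemma dd_add_sq_mul {f g : ℝ × E → ℝ} {z : ℝ × E} (hf : DifferentiableAt ℝ f z)
    (hg : DifferentiableAt ℝ g z) (a c : ℝ) (e : E) :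
    dd ((0 : ℝ), e) (fun z => a * f z + c * z.1 ^ 2 * g z) z =
      a * dd ((0 : ℝ), e) f z + c * z.1 ^ 2 * dd ((0 : ℝ), e) g z := by
  have h1 : HasFDerivAt (fun z : ℝ × E => z.1 ^ 2) _ z := (hasFDerivAt_fst (𝕜 := ℝ)).pow 2
  have h2 := ((hf.hasFDerivAt.const_mul a).add ((h1.const_mul c).mul hg.hasFDerivAt)).fderiv
  change fderiv ℝ _ z _ = _
  erw [h2]
  simp [dd]

variable {ι : Type*} [Fintype ι]

lemma dlap_add_sq_mul {f g : ℝ × E → ℝ} (hf : ContDiffOn ℝ ∞ f {z | z ≠ 0})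
    (hg : ContDiffOn ℝ ∞ g {z | z ≠ 0}) (a c : ℝ) (b : ι → E) {z : ℝ × E} (hz : z ≠ 0) :
    dlap (fun i => ((0 : ℝ), b i)) (fun z => a * f z + c * z.1 ^ 2 * g z) z =
      a * dlap (fun i => ((0 : ℝ), b i)) f z +
        c * z.1 ^ 2 * dlap (fun i => ((0 : ℝ), b i)) g z := by
  have hd : ∀ {h : ℝ × E → ℝ}, ContDiffOn ℝ ∞ h {z | z ≠ 0} → ∀ w, w ≠ 0 →
      DifferentiableAt ℝ h w := fun hh w hw =>
    ((hh w hw).contDiffAt (isOpen_ne_zero.mem_nhds hw)).differentiableAt (by simp)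
  simp only [dlap, Finset.mul_sum, ← Finset.sum_add_distrib]
  refine Finset.sum_congr rfl fun i _ => ?_
  rw [← dd_add_sq_mul (f := dd _ f) (g := dd _ g) (hd (hf.ddl_infty isOpen_ne_zero [_]) z hz)
    (hd (hg.ddl_infty isOpen_ne_zero [_]) z hz)]
  refine (EventuallyEq.dd ?_ _).eq_of_nhds
  filter_upwards [isOpen_ne_zero.mem_nhds hz] with w hw
  exact dd_add_sq_mul (hd hf w hw) (hd hg w hw) a c _

lemma dlap_regKer (q : ℝ) (b : OrthonormalBasis ι ℝ E) {z : ℝ × E} (hz : z ≠ 0) :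
    dlap (fun i => ((0 : ℝ), b i)) (regKer q) z =
      2 * q * (Fintype.card ι + 2 * q - 2) * regKer (q - 1) z +
        (-4 * q * (q - 1)) * z.1 ^ 2 * regKer (q - 2) z := by
  have key : ∀ i, dd ((0 : ℝ), b i) (dd ((0 : ℝ), b i) (regKer q)) z =
      2 * q * regKer (q - 1) z + 4 * q * (q - 1) * regKer (q - 2) z * (inner ℝ z.2 (b i)) ^ 2 := by
    intro i
    have h1 : dd ((0 : ℝ), b i) (regKer q) =ᶠ[𝓝 z]
        fun z => 2 * q * inner ℝ z.2 (b i) * regKer (q - 1) z := by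
      filter_upwards [isOpen_ne_zero.mem_nhds hz] with w hw
      exact dd_regKer q _ hw
    have h2 : DifferentiableAt ℝ (regKer (q - 1) : ℝ × E → ℝ) z :=
      ((contDiffOn_regKer (q - 1) z hz).contDiffAt
        (isOpen_ne_zero.mem_nhds hz)).differentiableAt (by simp)
    rw [(h1.dd _).eq_of_nhds, dd_inner_mul h2,
      dd_regKer _ _ hz, b.orthonormal.1 i, show q - 1 - 1 = q - 2 by ring]
    ring
  have hs : ∑ i, (inner ℝ z.2 (b i)) ^ 2 = ‖z.2‖ ^ 2 := by
    simpa using b.sum_sq_norm_inner_left z.2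
  rw [dlap, Finset.sum_congr rfl fun i _ => key i, Finset.sum_add_distrib,
    ← Finset.mul_sum, ← Finset.mul_sum, hs,
    regKer_eq_mul (q := q - 1) hz, show q - 1 - 1 = q - 2 by ring]
  simp
  ring

/-- The biharmonic operator applied to the regularized fundamental solution. -/
lemma dlap_dlap_regKer (b : OrthonormalBasis ι ℝ E) {q : ℝ} (hq : 2 * q = 4 - Fintype.card ι)
    {z : ℝ × E} (hz : z ≠ 0) :
    dlap (fun i => ((0 : ℝ), b i)) (dlap (fun i => ((0 : ℝ), b i)) (regKer q)) z =
      16 * q * (q - 1) * (q - 2) * (q - 3) * z.1 ^ 4 * regKer (q - 4) z := by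
  have h : dlap (fun i => ((0 : ℝ), b i)) (regKer q) =ᶠ[𝓝 z] fun z =>
      2 * q * (Fintype.card ι + 2 * q - 2) * regKer (q - 1) z +
        (-4 * q * (q - 1)) * z.1 ^ 2 * regKer (q - 2) z := by
    filter_upwards [isOpen_ne_zero.mem_nhds hz] with w hw
    exact dlap_regKer q b hw
  have hn : (Fintype.card ι : ℝ) = 4 - 2 * q := by linarith
  rw [(h.dlap _).eq_of_nhds, dlap_add_sq_mul (contDiffOn_regKer _) (contDiffOn_regKer _) _ _ _ hz,
    dlap_regKer _ b hz, dlap_regKer _ b hz, hn, show q - 1 - 1 = q - 2 by ring,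
    show q - 1 - 2 = q - 3 by ring, show q - 2 - 1 = q - 3 by ring,
    show q - 2 - 2 = q - 4 by ring]
  ring

end RegularizedKernel

section CutoffKernel

open Topology
open scoped ContDiff

variable {E : Type*} [NormedAddCommGroup E] [InnerProductSpace ℝ E] [FiniteDimensional ℝ E]
  {ι : Type*} [Fintype ι]

/-- A vertical direction in `ℝ × E`. -/
def vert (e : E) : ℝ × E := (0, e)

/-- A smooth function equal to `1` on the ball of radius `1 / 2`, supported in the unit ball. -/
noncomputable def cutoff (y : E) : ℝ :=
  (⟨1 / 2, 1, by norm_num, by norm_num⟩ : ContDiffBump (0 : E)) y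

/-- The truncated regularized kernel. -/
noncomputable def cutKer (q : ℝ) : ℝ × E → ℝ := fun z => cutoff z.2 * regKer q z

/-- The error made by the truncation in the equation of the regularized kernel. -/
noncomputable def cutRem (b : ι → E) (q : ℝ) : ℝ × E → ℝ := fun z =>
  dlap (fun i => vert (b i)) (dlap (fun i => vert (b i)) (cutKer q)) z -
    cutoff z.2 * dlap (fun i => vert (b i)) (dlap (fun i => vert (b i)) (regKer q)) z

lemma dd_slice {F : ℝ × E → ℝ} (hF : ContDiffOn ℝ ∞ F {z | z ≠ 0}) {ε : ℝ} (hε : ε ≠ 0) (e : E) :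
    (fun y => dd (vert e) F (ε, y)) = dd e fun y => F (ε, y) := by
  ext y
  have hz : (ε, y) ≠ 0 := fun h => hε (congrArg Prod.fst h)
  have h1 : DifferentiableAt ℝ F (ε, y) :=
    ((hF _ hz).contDiffAt (isOpen_ne_zero.mem_nhds hz)).differentiableAt (by simp)
  have h2 := (h1.hasFDerivAt.comp y (hasFDerivAt_prodMk_right ε y)).fderiv
  change _ = fderiv ℝ (F ∘ fun y => (ε, y)) y e
  rw [h2]
  simp [dd, vert]

lemma ddl_slice {F : ℝ × E → ℝ} (hF : ContDiffOn ℝ ∞ F {z | z ≠ 0}) {ε : ℝ} (hε : ε ≠ 0)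
    (l : List E) :
    (fun y => ddl (l.map vert) F (ε, y)) = ddl l fun y => F (ε, y) := by
  induction l with
  | nil => rfl
  | cons e l ih =>
    rw [ddl_cons, ← ih, ← dd_slice (hF.ddl_infty isOpen_ne_zero _) hε]
    rfl

lemma dlap_slice {F : ℝ × E → ℝ} (hF : ContDiffOn ℝ ∞ F {z | z ≠ 0}) {ε : ℝ} (hε : ε ≠ 0)
    (b : ι → E) :
    (fun y => dlap (fun i => vert (b i)) F (ε, y)) = dlap b fun y => F (ε, y) := by
  ext y
  exact Finset.sum_congr rfl fun i _ => congrFun (ddl_slice hF hε [b i, b i]) y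

lemma contDiff_cutoff : ContDiff ℝ ∞ (cutoff : E → ℝ) := ContDiffBump.contDiff _

lemma cutoff_eq_zero {y : E} (hy : 1 ≤ ‖y‖) : cutoff y = 0 :=
  ContDiffBump.zero_of_le_dist _ (by simpa using hy)

lemma cutoff_eq_one {y : E} (hy : ‖y‖ ≤ 1 / 2) : cutoff y = 1 :=
  ContDiffBump.one_of_mem_closedBall _ (by simpa using hy)

lemma cutoff_nonneg (y : E) : 0 ≤ cutoff y := ContDiffBump.nonneg _

lemma cutoff_le_one (y : E) : cutoff y ≤ 1 := ContDiffBump.le_one _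

lemma contDiffOn_cutKer (q : ℝ) : ContDiffOn ℝ ∞ (cutKer q : ℝ × E → ℝ) {z | z ≠ 0} :=
  (contDiff_cutoff.comp contDiff_snd).contDiffOn.mul (contDiffOn_regKer q)

lemma contDiffOn_cutRem (b : ι → E) (q : ℝ) :
    ContDiffOn ℝ ∞ (cutRem b q : ℝ × E → ℝ) {z | z ≠ 0} :=
  (((contDiffOn_cutKer q).dlap_infty _ isOpen_ne_zero).dlap_infty _ isOpen_ne_zero).sub
    ((contDiff_cutoff.comp contDiff_snd).contDiffOn.mul
      (((contDiffOn_regKer q).dlap_infty _ isOpen_ne_zero).dlap_infty _ isOpen_ne_zero))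

lemma cutKer_eventuallyEq (q : ℝ) {z : ℝ × E} (hz : ‖z.2‖ < 1 / 2) :
    cutKer q =ᶠ[𝓝 z] regKer q := by
  filter_upwards [(isOpen_lt (by fun_prop) continuous_const : IsOpen
    {z : ℝ × E | ‖z.2‖ < 1 / 2}).mem_nhds hz] with w hw
  rw [cutKer, cutoff_eq_one (le_of_lt hw), one_mul]

lemma cutKer_eventuallyEq_zero (q : ℝ) {z : ℝ × E} (hz : 1 < ‖z.2‖) :
    cutKer q =ᶠ[𝓝 z] fun _ => 0 := by
  filter_upwards [(isOpen_lt continuous_const (by fun_prop) : IsOpen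
    {z : ℝ × E | 1 < ‖z.2‖}).mem_nhds hz] with w hw
  rw [cutKer, cutoff_eq_zero (le_of_lt hw), zero_mul]

lemma cutRem_eventuallyEq_zero (b : ι → E) (q : ℝ) {z : ℝ × E} (hz : ‖z.2‖ < 1 / 2) :
    cutRem b q =ᶠ[𝓝 z] fun _ => 0 := by
  filter_upwards [(isOpen_lt (by fun_prop) continuous_const : IsOpen
    {z : ℝ × E | ‖z.2‖ < 1 / 2}).mem_nhds hz] with w hw
  rw [cutRem, cutoff_eq_one (le_of_lt hw), one_mul,
    (((cutKer_eventuallyEq q hw).dlap _).dlap _).eq_of_nhds, sub_self]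

lemma cutRem_eventuallyEq_zero' (b : ι → E) (q : ℝ) {z : ℝ × E} (hz : 1 < ‖z.2‖) :
    cutRem b q =ᶠ[𝓝 z] fun _ => 0 := by
  filter_upwards [(isOpen_lt continuous_const (by fun_prop) : IsOpen
    {z : ℝ × E | 1 < ‖z.2‖}).mem_nhds hz] with w hw
  have h0 : dlap (fun i => vert (b i)) (fun _ : ℝ × E => (0 : ℝ)) = fun _ => 0 := by
    ext x
    exact Finset.sum_eq_zero fun i _ => congrFun (ddl_zero [vert (b i), vert (b i)]) x
  rw [cutRem, cutoff_eq_zero (le_of_lt hw), zero_mul,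
    (((cutKer_eventuallyEq_zero q hw).dlap _).dlap _).eq_of_nhds, h0, h0, sub_zero]

lemma exists_bound_annulus {F : ℝ × E → ℝ} (hF : ContinuousOn F {z | z ≠ 0}) :
    ∃ C, 0 ≤ C ∧ ∀ ε ∈ Set.Icc (0 : ℝ) 1, ∀ y : E, 1 / 2 ≤ ‖y‖ → ‖y‖ ≤ 1 → |F (ε, y)| ≤ C := by
  have hK : IsCompact (Set.Icc (0 : ℝ) 1 ×ˢ (closedBall (0 : E) 1 \ ball 0 (1 / 2))) :=
    isCompact_Icc.prod ((isCompact_closedBall 0 1).diff isOpen_ball)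
  obtain ⟨C, hC⟩ := hK.exists_bound_of_continuousOn (hF.mono fun z hz h => by
    have := hz.2.2
    simp [h] at this)
  refine ⟨max C 0, le_max_right _ _, fun ε hε y h1 h2 => (hC (ε, y) ⟨hε, ?_, ?_⟩).trans
    (le_max_left _ _)⟩
  · simpa using h2
  · simpa using h1

lemma exists_ddl_cutKer_bound (q : ℝ) (l : List E) (hq : 2 * q ≤ l.length) :
    ∃ C, 0 ≤ C ∧ ∀ ε ∈ Set.Icc (0 : ℝ) 1, ∀ y : E, y ≠ 0 → ‖y‖ ≤ 1 →
      |ddl (l.map vert) (cutKer q) (ε, y)| ≤ C * ‖y‖ ^ (2 * q - l.length) := by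
  obtain ⟨C₁, hC₁, h1⟩ := ((regKer_posHomog (E := E) q).ddl (l.map vert)).exists_bound
    ((contDiffOn_regKer q).ddl_infty isOpen_ne_zero _).continuousOn
  obtain ⟨C₂, hC₂, h2⟩ := exists_bound_annulus
    ((contDiffOn_cutKer (E := E) q).ddl_infty isOpen_ne_zero (l.map vert)).continuousOn
  refine ⟨C₁ + C₂, by positivity, fun ε hε y hy hy1 => ?_⟩
  have hy0 : 0 < ‖y‖ := norm_pos_iff.2 hy
  have hm : 2 * q - l.length ≤ 0 := by linarith
  have hp : 0 ≤ ‖y‖ ^ (2 * q - l.length) := by positivity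
  rcases lt_or_ge ‖y‖ (1 / 2) with h | h
  · rw [((cutKer_eventuallyEq q (z := (ε, y)) h).ddl _).eq_of_nhds]
    have hz : (ε, y) ≠ 0 := fun h => hy (congrArg Prod.snd h)
    have h3 : ‖(ε, y)‖ ^ (2 * q - l.length) ≤ ‖y‖ ^ (2 * q - l.length) :=
      Real.rpow_le_rpow_of_nonpos hy0 (le_max_right _ _) hm
    have h4 := h1 _ hz
    rw [List.length_map] at h4
    nlinarith
  · have h3 : 1 ≤ ‖y‖ ^ (2 * q - l.length) := Real.one_le_rpow_of_pos_of_le_one_of_nonpos hy0 hy1 hm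
    have h4 := h2 ε hε y h hy1
    nlinarith

lemma exists_ddl_cutRem_bound (b : ι → E) (q : ℝ) (l : List E) :
    ∃ C, 0 ≤ C ∧ ∀ ε ∈ Set.Icc (0 : ℝ) 1, ∀ y : E, |ddl (l.map vert) (cutRem b q) (ε, y)| ≤ C := by
  obtain ⟨C, hC, h2⟩ := exists_bound_annulus
    ((contDiffOn_cutRem b q).ddl_infty isOpen_ne_zero (l.map vert)).continuousOn
  refine ⟨C, hC, fun ε hε y => ?_⟩
  rcases lt_or_ge ‖y‖ (1 / 2) with h | h
  · rw [((cutRem_eventuallyEq_zero b q (z := (ε, y)) h).ddl _).eq_of_nhds, ddl_zero]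
    simpa using hC
  rcases lt_or_ge 1 ‖y‖ with h' | h'
  · rw [((cutRem_eventuallyEq_zero' b q (z := (ε, y)) h').ddl _).eq_of_nhds, ddl_zero]
    simpa using hC
  · exact h2 ε hε y h h'

lemma ddl_cutRem_eq_zero (b : ι → E) (q : ℝ) (l : List E) (ε : ℝ) {y : E} (hy : 1 < ‖y‖) :
    ddl (l.map vert) (cutRem b q) (ε, y) = 0 := by
  rw [((cutRem_eventuallyEq_zero' b q (z := (ε, y)) hy).ddl _).eq_of_nhds, ddl_zero]

lemma contDiff_slice {F : ℝ × E → ℝ} (hF : ContDiffOn ℝ ∞ F {z | z ≠ 0}) {ε : ℝ} (hε : ε ≠ 0) :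
    ContDiff ℝ ∞ fun y => F (ε, y) :=
  contDiffOn_univ.1 (hF.comp (contDiff_prodMk_right ε).contDiffOn
    fun _ _ h => hε (congrArg Prod.fst h))

lemma tsupport_cutKer_subset (q ε : ℝ) :
    tsupport (fun y : E => cutKer q (ε, y)) ⊆ closedBall 0 1 := by
  refine closure_minimal (fun y hy => ?_) isClosed_closedBall
  by_contra h
  refine hy ?_
  change cutKer q (ε, y) = 0
  rw [cutKer, cutoff_eq_zero, zero_mul]
  simpa using (not_le.1 fun h' => h (mem_closedBall_zero_iff.2 h')).le

lemma hasCompactSupport_cutKer (q ε : ℝ) : HasCompactSupport fun y : E => cutKer q (ε, y) :=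
  (isCompact_closedBall 0 1).of_isClosed_subset (isClosed_tsupport _) (tsupport_cutKer_subset q ε)

end CutoffKernel

section InteriorEstimates

open Topology
open scoped ContDiff

variable {E : Type*} [NormedAddCommGroup E] [InnerProductSpace ℝ E] [FiniteDimensional ℝ E]
  [MeasurableSpace E] [BorelSpace E] {ι : Type*} [Fintype ι]

lemma integrable_indicator_norm_rpow (hd : 0 < Module.finrank ℝ E) {s : ℝ}
    (hs : -(Module.finrank ℝ E : ℝ) < s) :
    Integrable fun y : E => (Set.Iic (1 : ℝ)).indicator (fun t => t ^ s) ‖y‖ := by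
  have : Nontrivial E := Module.nontrivial_of_finrank_pos (R := ℝ) hd
  rw [integrable_fun_norm_addHaar volume (f := (Set.Iic (1 : ℝ)).indicator fun t => t ^ s)]
  have h1 : IntegrableOn (fun t : ℝ => t ^ (s + (Module.finrank ℝ E - 1))) (Set.Ioc 0 1) := by
    have := intervalIntegral.intervalIntegrable_rpow' (a := 0) (b := 1)
      (r := s + (Module.finrank ℝ E - 1)) (by linarith)
    rwa [intervalIntegrable_iff_integrableOn_Ioc_of_le zero_le_one] at this
  have h2 : IntegrableOn ((Set.Iic (1 : ℝ)).indicator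
      (fun t : ℝ => t ^ (s + (Module.finrank ℝ E - 1)))) (Set.Ioi 0) := by
    rw [integrableOn_indicator_iff measurableSet_Iic]
    have e : Set.Iic (1 : ℝ) ∩ Set.Ioi 0 = Set.Ioc 0 1 := by ext t; simp [and_comm]
    rwa [e]
  refine h2.congr_fun (fun t ht => ?_) measurableSet_Ioi
  have ht0 : (0 : ℝ) < t := ht
  by_cases h : t ≤ 1
  · rw [Set.indicator_of_mem (Set.mem_Iic.2 h), Set.indicator_of_mem (Set.mem_Iic.2 h),
      smul_eq_mul, Real.rpow_add ht0, mul_comm,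
      ← Real.rpow_natCast, Nat.cast_sub hd, Nat.cast_one]
  · rw [Set.indicator_of_notMem (by simpa using h),
      Set.indicator_of_notMem (by simpa using h), smul_zero]

lemma exists_mollifier_mass (hd : 0 < Module.finrank ℝ E) {q : ℝ}
    (hq : 2 * q = 4 - Module.finrank ℝ E) :
    ∃ m : ℝ, 0 < m ∧ ∀ f : E → ℝ, Integrable f → ContinuousAt f 0 →
      Tendsto (fun ε : ℝ => ∫ y : E, ε ^ 4 * regKer (q - 4) (ε, y) * f y) (𝓝[>] 0)
        (𝓝 (m * f 0)) := by
  have : Nontrivial E := Module.nontrivial_of_finrank_pos (R := ℝ) hd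
  obtain ⟨d, hdd⟩ : ∃ d : ℝ, d = Module.finrank ℝ E := ⟨_, rfl⟩
  rw [← hdd] at hq
  set ψ : E → ℝ := fun y => (1 + ‖y‖ ^ 2) ^ (-(d + 4) / 2) with hψ
  have hψi : Integrable ψ := integrable_rpow_neg_one_add_norm_sq (by linarith)
  have hψ0 : ∀ y, 0 < ψ y := fun y => by positivity
  have hm : 0 < ∫ y, ψ y := by
    rw [integral_pos_iff_support_of_nonneg (fun y => (hψ0 y).le) hψi]
    have : Function.support ψ = Set.univ := Set.eq_univ_of_forall fun y => (hψ0 y).ne'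
    rw [this]
    exact isOpen_univ.measure_pos _ Set.univ_nonempty
  refine ⟨∫ y, ψ y, hm, fun f hf hf0 => ?_⟩
  have h0 : Tendsto (fun x : E => ‖x‖ ^ Module.finrank ℝ E * (ψ x / ∫ y, ψ y))
      (Bornology.cobounded E) (𝓝 0) := by
    have h1 : Tendsto (fun x : E => (∫ y, ψ y)⁻¹ * ‖x‖⁻¹) (Bornology.cobounded E) (𝓝 0) := by
      simpa using (tendsto_inv_atTop_zero.comp tendsto_norm_cobounded_atTop).const_mul
        (∫ y, ψ y)⁻¹
    refine squeeze_zero' (Eventually.of_forall fun x => ?_) ?_ h1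
    · have := hψ0 x
      positivity
    · filter_upwards [tendsto_norm_cobounded_atTop.eventually_ge_atTop 1] with x hx
      have hx0 : 0 < ‖x‖ := by linarith
      have h2 : ψ x ≤ ‖x‖ ^ (-(d + 4)) := by
        calc ψ x ≤ (‖x‖ ^ 2) ^ (-(d + 4) / 2) :=
              Real.rpow_le_rpow_of_nonpos (by positivity) (by linarith) (by
                have : 0 ≤ d := by rw [hdd]; positivity
                linarith)
          _ = _ := by
            rw [← Real.rpow_natCast, ← Real.rpow_mul hx0.le]
            congr 1; push_cast; ring
      have h3 : ‖x‖ ^ Module.finrank ℝ E * ‖x‖ ^ (-(d + 4)) ≤ ‖x‖⁻¹ := by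
        rw [← Real.rpow_natCast, ← Real.rpow_add hx0, ← Real.rpow_neg_one]
        exact Real.rpow_le_rpow_of_exponent_le hx (by linarith)
      calc _ = (∫ y, ψ y)⁻¹ * (‖x‖ ^ Module.finrank ℝ E * ψ x) := by field_simp
        _ ≤ (∫ y, ψ y)⁻¹ * (‖x‖ ^ Module.finrank ℝ E * ‖x‖ ^ (-(d + 4))) := by gcongr
        _ ≤ _ := by gcongr
  have h1 := tendsto_integral_comp_smul_smul_of_integrable (μ := (volume : Measure E))
    (φ := fun y => ψ y / ∫ y, ψ y) (fun x => by have := hψ0 x; positivity)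
    (by rw [integral_div, div_self hm.ne']) h0 hf hf0
  have h2 := (h1.comp tendsto_inv_nhdsGT_zero).const_mul (∫ y, ψ y)
  refine h2.congr' ?_
  filter_upwards [self_mem_nhdsWithin] with ε hε
  have hε0 : (0 : ℝ) < ε := hε
  simp only [Function.comp]
  rw [← integral_const_mul]
  congr 1
  ext y
  have h3 : ε ^ 4 * regKer (q - 4) (ε, y) = (ε⁻¹) ^ Module.finrank ℝ E * ψ (ε⁻¹ • y) := by
    have e1 : q - 4 = -(d + 4) / 2 := by linarith
    have e2 : ‖y‖ ^ 2 + ε ^ 2 = ε ^ 2 * (1 + ‖ε⁻¹ • y‖ ^ 2) := by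
      rw [norm_smul, Real.norm_of_nonneg (by positivity)]; field_simp; ring
    rw [regKer, e1]
    simp only
    rw [e2, Real.mul_rpow (by positivity) (by positivity), ← mul_assoc]
    congr 1
    rw [← Real.rpow_natCast, ← Real.rpow_natCast, ← Real.rpow_natCast, ← Real.rpow_mul hε0.le,
      ← Real.rpow_add hε0, Real.inv_rpow hε0.le, ← Real.rpow_neg hε0.le]
    congr 1
    rw [← hdd]
    push_cast
    ring
  rw [h3, smul_eq_mul]
  field_simp

lemma tsupport_cutRem_subset (b : ι → E) (q ε : ℝ) :
    tsupport (fun y : E => cutRem b q (ε, y)) ⊆ closedBall 0 1 := by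
  refine closure_minimal (fun y hy => ?_) isClosed_closedBall
  by_contra h
  refine hy (ddl_cutRem_eq_zero b q [] ε ?_)
  simpa using h

lemma dlap_dlap_cutKer (b : OrthonormalBasis ι ℝ E) {q ε : ℝ}
    (hq : 2 * q = 4 - Fintype.card ι) (hε : ε ≠ 0) (y : E) :
    dlap b (dlap b fun y => cutKer q (ε, y)) y = cutRem b q (ε, y) +
      16 * q * (q - 1) * (q - 2) * (q - 3) * (ε ^ 4 * regKer (q - 4) (ε, y) * cutoff y) := by
  have hz : (ε, y) ≠ 0 := fun h => hε (congrArg Prod.fst h)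
  rw [cutRem]
  have h1 := dlap_dlap_regKer b hq hz
  change dlap (fun i => vert (b i)) (dlap (fun i => vert (b i)) (regKer q)) _ = _ at h1
  rw [h1, ← dlap_slice (contDiffOn_cutKer q) hε b,
    ← dlap_slice ((contDiffOn_cutKer q).dlap_infty _ isOpen_ne_zero) hε b]
  ring

lemma exists_ddl_le (hd : 5 ≤ Module.finrank ℝ E) (b : OrthonormalBasis ι ℝ E) (l : List E)
    (hl : l.length ≤ 3) :
    ∃ C, 0 ≤ C ∧ ∀ (v : E → ℝ) (U : Set E) (A : ℝ), IsOpen U → closedBall 0 1 ⊆ U →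
      ContDiffOn ℝ 4 v U → (∀ y ∈ closedBall (0 : E) 1, |v y| ≤ A) →
      (∀ y ∈ closedBall (0 : E) 1, |dlap b (dlap b v) y| ≤ A) → |ddl l v 0| ≤ C * A := by
  have : Nontrivial E := Module.nontrivial_of_finrank_pos (R := ℝ) (by lia)
  have hcard : Module.finrank ℝ E = Fintype.card ι := Module.finrank_eq_card_basis b.toBasis
  obtain ⟨q, hq⟩ : ∃ q : ℝ, 2 * q = 4 - Module.finrank ℝ E :=
    ⟨(4 - Module.finrank ℝ E) / 2, by ring⟩
  have hd' : (5 : ℝ) ≤ Module.finrank ℝ E := by exact_mod_cast hd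
  have hl' : (l.length : ℝ) ≤ 3 := by exact_mod_cast hl
  have hl0 : (0 : ℝ) ≤ l.length := by positivity
  obtain ⟨m, hm, hlim⟩ := exists_mollifier_mass (E := E) (by lia) hq
  obtain ⟨K, hKd⟩ : ∃ K, K = 16 * q * (q - 1) * (q - 2) * (q - 3) := ⟨_, rfl⟩
  have hK : 0 < K := by
    have h1 : 0 < q * (q - 1) := mul_pos_of_neg_of_neg (by linarith) (by linarith)
    have h2 : 0 < (q - 2) * (q - 3) := mul_pos_of_neg_of_neg (by linarith) (by linarith)
    rw [hKd]
    nlinarith [mul_pos h1 h2]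
  obtain ⟨C₁, hC₁, h1⟩ := exists_ddl_cutKer_bound q l.reverse (by simp; linarith)
  obtain ⟨C₂, hC₂, h2⟩ := exists_ddl_cutRem_bound b q l.reverse
  rw [List.length_reverse] at h1
  set s := 2 * q - l.length with hs
  have hI := integrable_indicator_norm_rpow (E := E) (by lia) (s := s) (by linarith)
  set I := ∫ y : E, (Set.Iic (1 : ℝ)).indicator (fun t => t ^ s) ‖y‖ with hId
  have hI0 : 0 ≤ I := integral_nonneg fun y => Set.indicator_apply_nonneg fun _ => by positivity
  set W := volume.real (closedBall (0 : E) 1) with hW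
  refine ⟨(C₁ * I + C₂ * W) / (K * m), by positivity, fun v U A hU hBU hv hvA hvB => ?_⟩
  have hA : 0 ≤ A := (abs_nonneg _).trans (hvA 0 (by simp))
  have hlv : ContDiffOn ℝ l.length v U := hv.of_le (by exact_mod_cast hl.trans (by norm_num))
  have hD : ContinuousOn (ddl l v) U :=
      (ContDiffOn.ddl hU l (m := 0) (by simpa using hlv)).continuousOn
  have hcs : tsupport (cutoff : E → ℝ) ⊆ closedBall 0 1 := by
    refine closure_minimal (fun y hy => ?_) isClosed_closedBall
    by_contra h
    exact hy (cutoff_eq_zero (by simpa using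
        (not_le.1 fun h' => h (mem_closedBall_zero_iff.2 h')).le))
  have hcc : HasCompactSupport (cutoff : E → ℝ) :=
    (isCompact_closedBall 0 1).of_isClosed_subset (isClosed_tsupport _) hcs
  have h0 := (hlim (fun y => cutoff y * ddl l v y)
    (integrable_mul_of_tsupport contDiff_cutoff.continuous hcc hU (hcs.trans hBU) hD)
    (contDiff_cutoff.continuous.continuousAt.mul
      (hD.continuousAt (hU.mem_nhds (hBU (by simp)))))).const_mul K
  rw [cutoff_eq_one (by simp), one_mul] at h0
  have hbd : |K * (m * ddl l v 0)| ≤ C₁ * A * I + C₂ * A * W := by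
    refine le_of_tendsto h0.abs ?_
    filter_upwards [Ioc_mem_nhdsGT zero_lt_one] with ε hε
    have hε0 : ε ≠ 0 := hε.1.ne'
    have hεI : ε ∈ Set.Icc (0 : ℝ) 1 := ⟨hε.1.le, hε.2⟩
    set φ : E → ℝ := fun y => cutKer q (ε, y) with hφd
    set R : E → ℝ := fun y => cutRem b q (ε, y) with hRd
    have hφ : ContDiff ℝ ∞ φ := contDiff_slice (contDiffOn_cutKer q) hε0
    have hR : ContDiff ℝ ∞ R := contDiff_slice (contDiffOn_cutRem b q) hε0
    have hφs : tsupport φ ⊆ closedBall 0 1 := tsupport_cutKer_subset q ε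
    have hRs : tsupport R ⊆ closedBall 0 1 := tsupport_cutRem_subset b q ε
    have hcpt : ∀ {f : E → ℝ}, tsupport f ⊆ closedBall 0 1 → HasCompactSupport f := fun hf =>
      (isCompact_closedBall 0 1).of_isClosed_subset (isClosed_tsupport _) hf
    have hφ2s : tsupport (dlap b (dlap b φ)) ⊆ closedBall 0 1 :=
      ((tsupport_dlap_subset b _).trans (tsupport_dlap_subset b _)).trans hφs
    have hφ2 : ContDiff ℝ ∞ (dlap b (dlap b φ)) := (hφ.dlap_infty b).dlap_infty b
    have e1 : K * ∫ y, ε ^ 4 * regKer (q - 4) (ε, y) * (cutoff y * ddl l v y) =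
        (∫ y, dlap b (dlap b φ) y * ddl l v y) - ∫ y, R y * ddl l v y := by
      rw [← integral_sub (integrable_mul_of_tsupport hφ2.continuous (hcpt hφ2s) hU
        (hφ2s.trans hBU) hD) (integrable_mul_of_tsupport hR.continuous (hcpt hRs) hU
        (hRs.trans hBU) hD), ← integral_const_mul]
      congr 1
      ext y
      rw [dlap_dlap_cutKer b (by rw [← hcard]; exact hq) hε0 y, ← hKd]
      ring
    have e2 : |∫ y, dlap b (dlap b φ) y * ddl l v y| ≤ C₁ * A * I := by
      have h3 := abs_integral_ddl_mul hφ2 (hcpt hφ2s) hU (hφ2s.trans hBU) l.reverse (v := v)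
        (by simpa using hlv)
      rw [List.reverse_reverse] at h3
      rw [← h3, ddl_dlap b (hφ.dlap_infty b), ddl_dlap b hφ]
      have hls := (tsupport_ddl_subset l.reverse φ).trans hφs
      rw [integral_dlap_dlap_mul b (hφ.ddl_infty _) (hcpt hls) hU (hls.trans hBU) hv, hId,
        ← integral_const_mul]
      rw [← Real.norm_eq_abs]
      refine norm_integral_le_of_norm_le (hI.const_mul _) ?_
      filter_upwards [compl_mem_ae_iff.2 (measure_singleton (0 : E))] with y hy
      rcases lt_or_ge 1 ‖y‖ with h | h
      · rw [Set.indicator_of_notMem (by simpa using h), image_eq_zero_of_notMem_tsupport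
          fun h' => not_le.2 h (mem_closedBall_zero_iff.1 (hls h'))]
        simp
      · rw [Set.indicator_of_mem (Set.mem_Iic.2 h), norm_mul, Real.norm_eq_abs, Real.norm_eq_abs,
          hφd, ← ddl_slice (contDiffOn_cutKer q) hε0]
        calc _ ≤ (C₁ * ‖y‖ ^ s) * A :=
              mul_le_mul (h1 ε hεI y hy h) (hvB y (by simpa using h)) (abs_nonneg _)
                (by positivity)
          _ = _ := by ring
    have e3 : |∫ y, R y * ddl l v y| ≤ C₂ * A * W := by
      have h3 := abs_integral_ddl_mul hR (hcpt hRs) hU (hRs.trans hBU) l.reverse (v := v)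
        (by simpa using hlv)
      rw [List.reverse_reverse] at h3
      have hls := (tsupport_ddl_subset l.reverse R).trans hRs
      rw [← h3, ← setIntegral_eq_integral_of_forall_compl_eq_zero (s := closedBall (0 : E) 1)
        fun y hy => by rw [image_eq_zero_of_notMem_tsupport fun h' => hy (hls h'), zero_mul]]
      rw [← Real.norm_eq_abs]
      refine norm_setIntegral_le_of_norm_le_const (isCompact_closedBall 0 1).measure_lt_top
        fun y hy => ?_
      rw [norm_mul, Real.norm_eq_abs, Real.norm_eq_abs, hRd,
        ← ddl_slice (contDiffOn_cutRem b q) hε0]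
      exact mul_le_mul (h2 ε hεI y) (hvA y hy) (abs_nonneg _) hC₂
    rw [e1]
    exact (abs_sub _ _).trans (add_le_add e2 e3)
  rw [abs_mul, abs_mul, abs_of_pos hK, abs_of_pos hm] at hbd
  rw [div_mul_eq_mul_div, le_div_iff₀ (by positivity)]
  linarith

end InteriorEstimates

section AffineScaling

open Topology
open scoped ContDiff

variable {V : Type*} [NormedAddCommGroup V] [NormedSpace ℝ V] {ι : Type*} [Fintype ι]

lemma dd_const_mul (a : ℝ) (f : V → ℝ) (e : V) :
    dd e (fun y => a * f y) = fun y => a * dd e f y := by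
  ext y
  have h : (fun y => a * f y) = a • f := rfl
  rw [dd, h, fderiv_const_smul_field]
  simp [dd]

lemma ddl_const_mul (a : ℝ) (f : V → ℝ) (l : List V) :
    ddl l (fun y => a * f y) = fun y => a * ddl l f y := by
  induction l with
  | nil => rfl
  | cons e l ih => rw [ddl_cons, ih, dd_const_mul, ddl_cons]

lemma dlap_const_mul (a : ℝ) (f : V → ℝ) (b : ι → V) :
    dlap b (fun y => a * f y) = fun y => a * dlap b f y := by
  ext y
  simp only [dlap, Finset.mul_sum]
  exact Finset.sum_congr rfl fun i _ => congrFun (ddl_const_mul a f [b i, b i]) y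

lemma dd_comp_affine (f : V → ℝ) (x : V) (c : ℝ) (e : V) :
    dd e (fun y => f (x + c • y)) = fun y => c * dd e f (x + c • y) := by
  ext y
  have h1 := fderiv_comp_smul (𝕜 := ℝ) (f := fun y => f (x + y)) (x := y) c
  rw [fderiv_comp_add_left] at h1
  rw [dd, h1]
  simp [dd]

lemma ddl_comp_affine (f : V → ℝ) (x : V) (c : ℝ) (l : List V) :
    ddl l (fun y => f (x + c • y)) = fun y => c ^ l.length * ddl l f (x + c • y) := by
  induction l with
  | nil => simp
  | cons e l ih =>
    rw [ddl_cons, ih, dd_const_mul, dd_comp_affine]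
    ext y
    simp [pow_succ, mul_assoc]

lemma dlap_comp_affine (f : V → ℝ) (x : V) (c : ℝ) (b : ι → V) :
    dlap b (fun y => f (x + c • y)) = fun y => c ^ 2 * dlap b f (x + c • y) := by
  ext y
  simp only [dlap, Finset.mul_sum]
  exact Finset.sum_congr rfl fun i _ => congrFun (ddl_comp_affine f x c [b i, b i]) y

lemma dlap_dlap_comp_affine (f : V → ℝ) (x : V) (c : ℝ) (b : ι → V) :
    dlap b (dlap b fun y => f (x + c • y)) = fun y => c ^ 4 * dlap b (dlap b f) (x + c • y) := by
  rw [dlap_comp_affine, dlap_const_mul, dlap_comp_affine]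
  ext y
  ring

end AffineScaling

section WeakSolutions

open Topology
open scoped ContDiff

variable {E : Type*} [NormedAddCommGroup E] [InnerProductSpace ℝ E] [FiniteDimensional ℝ E]
  [MeasurableSpace E] [BorelSpace E] {ι : Type*} [Fintype ι]

lemma integral_comp_affine (f : E → ℝ) (x : E) {R : ℝ} (hR : 0 < R) :
    ∫ y, f (x + R • y) = (R ^ Module.finrank ℝ E)⁻¹ * ∫ y, f y := by
  rw [Measure.integral_comp_smul volume (fun y => f (x + y)), integral_add_left_eq_self,
    abs_of_pos (by positivity), smul_eq_mul]

/-- Distributional solutions of `Δ²w = w ^ p` on the whole space. -/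
def WeakSol (b : ι → E) (p : ℝ) (w : E → ℝ) : Prop :=
  ∀ φ : E → ℝ, ContDiff ℝ ∞ φ → HasCompactSupport φ →
    ∫ y, dlap b (dlap b φ) y * w y = ∫ y, φ y * w y ^ p

lemma WeakSol.comp_affine {b : ι → E} {p : ℝ} {w : E → ℝ} (hw : WeakSol b p w) (x : E) {R : ℝ}
    (hR : 0 < R) {φ : E → ℝ} (hφ : ContDiff ℝ ∞ φ) (hc : HasCompactSupport φ) :
    ∫ y, dlap b (dlap b φ) y * w (x + R • y) = ∫ y, φ y * (R ^ 4 * w (x + R • y) ^ p) := by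
  have hR' : R ≠ 0 := hR.ne'
  have e : ∀ y, -(R⁻¹ • x) + R⁻¹ • (x + R • y) = y := fun y => by
    rw [smul_add, smul_smul, inv_mul_cancel₀ hR', one_smul]; abel
  have h := hw (fun z => φ (-(R⁻¹ • x) + R⁻¹ • z))
    (hφ.comp (contDiff_const.add (contDiff_const_smul _)))
    (hc.comp_homeomorph ((Homeomorph.smulOfNeZero R⁻¹ (inv_ne_zero hR')).trans
      (Homeomorph.addLeft (-(R⁻¹ • x)))))
  rw [dlap_dlap_comp_affine] at h
  have h1 := integral_comp_affine
    (fun z => R⁻¹ ^ 4 * dlap b (dlap b φ) (-(R⁻¹ • x) + R⁻¹ • z) * w z) x hR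
  have h2 := integral_comp_affine (fun z => φ (-(R⁻¹ • x) + R⁻¹ • z) * w z ^ p) x hR
  rw [h, ← h2] at h1
  simp only [e] at h1
  have h3 : ∀ y, φ y * (R ^ 4 * w (x + R • y) ^ p) = R ^ 4 * (φ y * w (x + R • y) ^ p) :=
    fun y => by ring
  simp only [h3]
  rw [integral_const_mul, ← h1, ← integral_const_mul]
  congr 1
  ext y
  field_simp

lemma WeakSol.translate {b : ι → E} {p : ℝ} {w : E → ℝ} (hw : WeakSol b p w) (x : E) :
    WeakSol b p fun y => w (x + y) := fun φ hφ hc => by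
  simpa using hw.comp_affine x one_pos hφ hc

end WeakSolutions

section WeakLiouville

open Topology
open scoped ContDiff

variable {E : Type*} [NormedAddCommGroup E] [InnerProductSpace ℝ E] [FiniteDimensional ℝ E]
  [MeasurableSpace E] [BorelSpace E] {ι : Type*} [Fintype ι]

lemma integrableOn_norm_rpow_mul (hd : 0 < Module.finrank ℝ E) {s : ℝ}
    (hs : -(Module.finrank ℝ E : ℝ) < s) (hs0 : s ≤ 0) {g : E → ℝ} (hg : Continuous g) {B : ℝ}
    (hgB : ∀ y, |g y| ≤ B) (ρ : ℝ) :
    IntegrableOn (fun y => ‖y‖ ^ s * g y) (closedBall 0 ρ) := by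
  have hB : 0 ≤ B := (abs_nonneg _).trans (hgB 0)
  have h1 := ((integrable_indicator_norm_rpow hd hs).integrableOn (s := closedBall (0 : E) ρ)).add
    (integrableOn_const (C := (1 : ℝ)) (isCompact_closedBall (0 : E) ρ).measure_lt_top.ne)
  refine (h1.const_mul B).mono'
    ((measurable_norm.pow_const s).mul hg.measurable).aestronglyMeasurable
    (Eventually.of_forall fun y => ?_)
  have h2 : ‖y‖ ^ s ≤ (Set.Iic (1 : ℝ)).indicator (fun t => t ^ s) ‖y‖ + 1 := by
    rcases le_or_gt ‖y‖ 1 with h | h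
    · rw [Set.indicator_of_mem (Set.mem_Iic.2 h)]
      linarith
    · rw [Set.indicator_of_notMem (by simpa using h), zero_add]
      exact Real.rpow_le_one_of_one_le_of_nonpos h.le hs0
  rw [norm_mul, Real.norm_of_nonneg (by positivity), Real.norm_eq_abs, mul_comm B]
  exact mul_le_mul h2 (hgB y) (abs_nonneg _) (le_trans (by positivity) h2)

/-- The representation formula of a weak solution on a ball, with its truncation error. -/
lemma exists_truncated_rep (hd : 5 ≤ Module.finrank ℝ E) (b : OrthonormalBasis ι ℝ E) :
    ∃ κ C : ℝ, 0 < κ ∧ 0 ≤ C ∧ ∀ (p : ℝ) (w : E → ℝ) (A : ℝ), 0 ≤ p → Continuous w →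
      (∀ x, 0 ≤ w x) → (∀ x, w x ≤ A) → WeakSol b p w → ∀ R : ℝ, 0 < R →
      |κ * w 0 - ∫ z, cutoff (R⁻¹ • z) * (‖z‖ ^ (-((Module.finrank ℝ E : ℝ) - 4)) * w z ^ p)| ≤
        C * ∫ y in closedBall (0 : E) 1, w (R • y) := by
  have : Nontrivial E := Module.nontrivial_of_finrank_pos (R := ℝ) (by lia)
  have hcard : Module.finrank ℝ E = Fintype.card ι := Module.finrank_eq_card_basis b.toBasis
  obtain ⟨q, hq⟩ : ∃ q : ℝ, 2 * q = 4 - Module.finrank ℝ E :=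
    ⟨(4 - Module.finrank ℝ E) / 2, by ring⟩
  have hd' : (5 : ℝ) ≤ Module.finrank ℝ E := by exact_mod_cast hd
  obtain ⟨m, hm, hlim⟩ := exists_mollifier_mass (E := E) (by lia) hq
  obtain ⟨K, hKd⟩ : ∃ K, K = 16 * q * (q - 1) * (q - 2) * (q - 3) := ⟨_, rfl⟩
  have hK : 0 < K := by
    have h1 : 0 < q * (q - 1) := mul_pos_of_neg_of_neg (by linarith) (by linarith)
    have h2 : 0 < (q - 2) * (q - 3) := mul_pos_of_neg_of_neg (by linarith) (by linarith)
    rw [hKd]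
    nlinarith [mul_pos h1 h2]
  obtain ⟨C₁, hC₁, h1⟩ := exists_ddl_cutKer_bound (E := E) q [] (by simp; linarith)
  obtain ⟨C₂, hC₂, h2⟩ := exists_ddl_cutRem_bound b q []
  simp only [List.map_nil, ddl_nil, List.length_nil, Nat.cast_zero, sub_zero] at h1 h2
  refine ⟨K * m, C₂, mul_pos hK hm, hC₂, fun p w A hp hw hw0 hwA hsol R hR => ?_⟩
  have hcs : tsupport (cutoff : E → ℝ) ⊆ closedBall 0 1 := by
    refine closure_minimal (fun y hy => ?_) isClosed_closedBall
    by_contra h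
    exact hy (cutoff_eq_zero (by simpa using
        (not_le.1 fun h' => h (mem_closedBall_zero_iff.2 h')).le))
  have hcpt : ∀ {f : E → ℝ}, tsupport f ⊆ closedBall 0 1 → HasCompactSupport f := fun hf =>
    (isCompact_closedBall 0 1).of_isClosed_subset (isClosed_tsupport _) hf
  have hwR : Continuous fun y => w (R • y) := hw.comp (continuous_const_smul R)
  have hwp : Continuous fun y => R ^ 4 * w (R • y) ^ p :=
    continuous_const.mul (hwR.rpow_const fun _ => Or.inr hp)
  have hA : 0 ≤ A := (hw0 0).trans (hwA 0)
  have hwpB : ∀ y, |R ^ 4 * w (R • y) ^ p| ≤ R ^ 4 * A ^ p := fun y => by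
    rw [abs_of_nonneg (mul_nonneg (by positivity) (Real.rpow_nonneg (hw0 _) _))]
    gcongr
    exacts [hw0 _, hwA _]
  have hInt : ∀ {f g : E → ℝ}, Continuous f → tsupport f ⊆ closedBall 0 1 → Continuous g →
      Integrable fun y => f y * g y := fun hf hfs hg =>
    (hf.mul hg).integrable_of_hasCompactSupport ((hcpt hfs).mul_right)
  -- the two limits
  have l1 := (hlim (fun y => cutoff y * w (R • y)) (hInt contDiff_cutoff.continuous hcs hwR)
    (contDiff_cutoff.continuous.mul hwR).continuousAt).const_mul K
  rw [cutoff_eq_one (by simp), one_mul, smul_zero, ← mul_assoc] at l1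
  have l2 : Tendsto (fun ε : ℝ => ∫ y, cutKer q (ε, y) * (R ^ 4 * w (R • y) ^ p)) (𝓝[>] 0)
      (𝓝 (∫ y, cutKer q (0, y) * (R ^ 4 * w (R • y) ^ p))) := by
    have hI := (integrable_indicator_norm_rpow (E := E) (by lia) (s := 2 * q)
      (by linarith)).const_mul
      (C₁ * (R ^ 4 * A ^ p))
    refine tendsto_integral_filter_of_dominated_convergence _ ?_ ?_ hI ?_
    · filter_upwards [self_mem_nhdsWithin] with ε hε
      exact ((contDiff_slice (contDiffOn_cutKer q) (ne_of_gt hε)).continuous.mul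
        hwp).aestronglyMeasurable
    · filter_upwards [Ioc_mem_nhdsGT zero_lt_one] with ε hε
      filter_upwards [compl_mem_ae_iff.2 (measure_singleton (0 : E))] with y hy
      rcases lt_or_ge 1 ‖y‖ with h | h
      · rw [Set.indicator_of_notMem (by simpa using h), cutKer, cutoff_eq_zero h.le]
        simp
      · rw [Set.indicator_of_mem (Set.mem_Iic.2 h), norm_mul, Real.norm_eq_abs, Real.norm_eq_abs]
        calc _ ≤ (C₁ * ‖y‖ ^ (2 * q)) * (R ^ 4 * A ^ p) :=
              mul_le_mul (h1 ε ⟨hε.1.le, hε.2⟩ y hy h) (hwpB y) (abs_nonneg _) (by positivity)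
          _ = _ := by ring
    · filter_upwards [compl_mem_ae_iff.2 (measure_singleton (0 : E))] with y hy
      have h3 : ContinuousAt (cutKer q) ((0 : ℝ), y) :=
          (contDiffOn_cutKer q).continuousOn.continuousAt
        (isOpen_ne_zero.mem_nhds fun h => hy (congrArg Prod.snd h))
      have h4 : ContinuousAt (fun ε : ℝ => cutKer q (ε, y)) 0 :=
        ContinuousAt.comp (f := fun ε : ℝ => (ε, y)) h3 (by fun_prop)
      exact (h4.tendsto.mono_left nhdsWithin_le_nhds).mul_const _
  have e0 : ∫ y, cutKer q (0, y) * (R ^ 4 * w (R • y) ^ p) =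
      ∫ z, cutoff (R⁻¹ • z) * (‖z‖ ^ (-((Module.finrank ℝ E : ℝ) - 4)) * w z ^ p) := by
    have h3 := integral_comp_affine (fun z : E => cutoff (R⁻¹ • z) *
      (‖z‖ ^ (-((Module.finrank ℝ E : ℝ) - 4)) * w z ^ p)) 0 hR
    rw [eq_inv_mul_iff_mul_eq₀ (by positivity), ← integral_const_mul] at h3
    rw [← h3]
    congr 1
    ext y
    have e1 : -((Module.finrank ℝ E : ℝ) - 4) = 2 * q := by linarith
    have e2 : R ^ Module.finrank ℝ E * R ^ (2 * q) = R ^ 4 := by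
      rw [← Real.rpow_natCast, ← Real.rpow_natCast, ← Real.rpow_add hR]
      congr 1; push_cast; linarith
    have e3 : (‖y‖ ^ 2) ^ q = ‖y‖ ^ (2 * q) := by
      rw [← Real.rpow_natCast, ← Real.rpow_mul (norm_nonneg y)]; norm_num
    simp only [zero_add, smul_smul, inv_mul_cancel₀ hR.ne', one_smul, cutKer, regKer]
    rw [norm_smul, Real.norm_of_nonneg hR.le, Real.mul_rpow hR.le (norm_nonneg y), e1, ← e2, ← e3]
    simp only [ne_eq, OfNat.ofNat_ne_zero, not_false_eq_true, zero_pow, add_zero]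
    ring
  rw [← e0]
  refine le_of_tendsto (l1.sub l2).abs ?_
  filter_upwards [Ioc_mem_nhdsGT zero_lt_one] with ε hε
  have hε0 : ε ≠ 0 := hε.1.ne'
  have hφ : ContDiff ℝ ∞ fun y : E => cutKer q (ε, y) := contDiff_slice (contDiffOn_cutKer q) hε0
  have hRm : ContDiff ℝ ∞ fun y => cutRem b q (ε, y) := contDiff_slice (contDiffOn_cutRem b q) hε0
  have hRs := tsupport_cutRem_subset b q ε
  have h3 := hsol.comp_affine 0 hR hφ (hasCompactSupport_cutKer q ε)
  have hφ2s : tsupport (dlap b (dlap b fun y => cutKer q (ε, y))) ⊆ closedBall 0 1 :=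
    ((tsupport_dlap_subset b _).trans (tsupport_dlap_subset b _)).trans (tsupport_cutKer_subset q ε)
  have hφ2 := (hφ.dlap_infty b).dlap_infty b
  simp only [zero_add] at h3
  have e1 : K * ∫ y, ε ^ 4 * regKer (q - 4) (ε, y) * (cutoff y * w (R • y)) =
      (∫ y, dlap b (dlap b fun y => cutKer q (ε, y)) y * w (R • y)) -
        ∫ y, cutRem b q (ε, y) * w (R • y) := by
    rw [← integral_sub (hInt hφ2.continuous hφ2s hwR) (hInt hRm.continuous hRs hwR),
      ← integral_const_mul]
    congr 1
    ext y
    rw [dlap_dlap_cutKer b (by rw [← hcard]; exact hq) hε0 y, ← hKd]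
    ring
  rw [e1, h3, sub_right_comm, sub_self, zero_sub, abs_neg,
    ← setIntegral_eq_integral_of_forall_compl_eq_zero (s := closedBall (0 : E) 1)
      fun y hy => by rw [image_eq_zero_of_notMem_tsupport (f := fun y => cutRem b q (ε, y))
        fun h' => hy (hRs h'), zero_mul],
    ← integral_const_mul, ← Real.norm_eq_abs]
  refine norm_integral_le_of_norm_le
    ((hwR.continuousOn.integrableOn_compact (isCompact_closedBall 0 1)).const_mul C₂)
    (Eventually.of_forall fun y => ?_)
  rw [norm_mul, Real.norm_eq_abs, Real.norm_of_nonneg (hw0 _)]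
  exact mul_le_mul_of_nonneg_right (h2 ε ⟨hε.1.le, hε.2⟩ y) (hw0 _)

end WeakLiouville

section WeakLiouville

open Topology
open scoped ContDiff

variable {E : Type*} [NormedAddCommGroup E] [InnerProductSpace ℝ E] [FiniteDimensional ℝ E]
  [MeasurableSpace E] [BorelSpace E] {ι : Type*} [Fintype ι]

lemma le_add_rpow_mul {p t η : ℝ} (hp : 1 < p) (hη : 0 < η) (ht : 0 ≤ t) :
    t ≤ η + η ^ (1 - p) * t ^ p := by
  rcases le_or_gt t η with h | h
  · have : 0 ≤ η ^ (1 - p) * t ^ p := by positivity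
    linarith
  · have ht0 : 0 < t := hη.trans h
    have h1 : t = t ^ (1 - p) * t ^ p := by
      rw [← Real.rpow_add ht0]; simp
    have h2 : t ^ (1 - p) * t ^ p ≤ η ^ (1 - p) * t ^ p := by
      gcongr ?_ * _
      exact Real.rpow_le_rpow_of_nonpos hη h.le (by linarith)
    linarith

/-- Bounded nonnegative weak solutions are given by the Riesz potential of their nonlinearity. -/
lemma exists_integral_rep (hd : 5 ≤ Module.finrank ℝ E) (b : OrthonormalBasis ι ℝ E) :
    ∃ κ : ℝ, 0 < κ ∧ ∀ (p : ℝ) (w : E → ℝ) (A : ℝ), 1 < p → Continuous w →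
      (∀ x, 0 ≤ w x) → (∀ x, w x ≤ A) → WeakSol b p w →
      Integrable (fun z => ‖z‖ ^ (-((Module.finrank ℝ E : ℝ) - 4)) * w z ^ p) ∧
      κ * w 0 = ∫ z, ‖z‖ ^ (-((Module.finrank ℝ E : ℝ) - 4)) * w z ^ p := by
  obtain ⟨κ, C, hκ, hC, hrep⟩ := exists_truncated_rep hd b
  refine ⟨κ, hκ, fun p w A hp hw hw0 hwA hsol => ?_⟩
  have : Nontrivial E := Module.nontrivial_of_finrank_pos (R := ℝ) (by lia)
  have hd' : (5 : ℝ) ≤ Module.finrank ℝ E := by exact_mod_cast hd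
  replace hrep := hrep p w A (by linarith) hw hw0 hwA hsol
  have hA : 0 ≤ A := (hw0 0).trans (hwA 0)
  have hwp : Continuous fun y => w y ^ p := hw.rpow_const fun _ => Or.inr (by linarith)
  have hwpB : ∀ y, |w y ^ p| ≤ A ^ p := fun y => by
    rw [abs_of_nonneg (Real.rpow_nonneg (hw0 _) _)]
    gcongr
    exacts [hw0 _, hwA _]
  obtain ⟨h, hh⟩ : ∃ h : E → ℝ, h = fun z => ‖z‖ ^ (-((Module.finrank ℝ E : ℝ) - 4)) * w z ^ p :=
    ⟨_, rfl⟩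
  have hloc : ∀ ρ, IntegrableOn h (closedBall 0 ρ) := fun ρ => by
    rw [hh]
    exact integrableOn_norm_rpow_mul (by lia) (by linarith) (by linarith) hwp hwpB ρ
  have hh0 : ∀ z, 0 ≤ h z := fun z => by
    rw [hh]
    exact mul_nonneg (by positivity) (Real.rpow_nonneg (hw0 _) _)
  rw [← hh]
  have hrep' : ∀ R : ℝ, 0 < R → |κ * w 0 - ∫ z, cutoff (R⁻¹ • z) * h z| ≤
      C * ∫ y in closedBall (0 : E) 1, w (R • y) := by
    rw [hh]; exact hrep
  obtain ⟨W, hW⟩ : ∃ W, W = volume.real (closedBall (0 : E) 1) := ⟨_, rfl⟩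
  have hW0 : 0 ≤ W := hW ▸ measureReal_nonneg
  have hwR : ∀ R : ℝ, IntegrableOn (fun y => w (R • y)) (closedBall (0 : E) 1) := fun R =>
    (hw.comp (continuous_const_smul R)).continuousOn.integrableOn_compact (isCompact_closedBall 0 1)
  have hcutm : ∀ R : ℝ, Continuous fun z : E => cutoff (R • z) := fun R =>
    contDiff_cutoff.continuous.comp (continuous_const_smul R)
  have hhm : AEStronglyMeasurable h := by
    rw [hh]
    exact ((measurable_norm.pow_const _).mul hwp.measurable).aestronglyMeasurable
  have hcut : ∀ R : ℝ, 0 < R → Integrable fun z => cutoff (R⁻¹ • z) * h z := fun R hR => by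
    refine (((integrable_indicator_iff measurableSet_closedBall).2 (hloc R))).mono'
      ((hcutm _).aestronglyMeasurable.mul hhm) (Eventually.of_forall fun z => ?_)
    by_cases hz : z ∈ closedBall 0 R
    · rw [Set.indicator_of_mem hz, norm_mul, Real.norm_of_nonneg (cutoff_nonneg _),
        Real.norm_of_nonneg (hh0 _)]
      exact mul_le_of_le_one_left (hh0 _) (cutoff_le_one _)
    · rw [Set.indicator_of_notMem hz, cutoff_eq_zero, zero_mul, norm_zero]
      rw [norm_smul, norm_inv, Real.norm_of_nonneg hR.le, ← div_eq_inv_mul, le_div_iff₀ hR, one_mul]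
      exact (by simpa using hz : R < ‖z‖).le
  have hInt : Integrable h := by
    refine (aecover_closedBall (x := (0 : E))
      (tendsto_natCast_atTop_atTop (R := ℝ))).integrable_of_integral_norm_bounded
      (κ * w 0 + C * (A * W)) (fun k => hloc k) ?_
    filter_upwards [eventually_gt_atTop 0] with k hk
    have hk0 : (0 : ℝ) < 2 * k := by positivity
    have h1 := (abs_le.1 (hrep' (2 * k) hk0)).1
    have h2 : ∫ y in closedBall (0 : E) 1, w ((2 * k : ℝ) • y) ≤ A * W := by
      have := setIntegral_mono (hwR (2 * k))
        (integrableOn_const (C := A) (isCompact_closedBall (0 : E) 1).measure_lt_top.ne)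
        fun y => hwA _
      rwa [setIntegral_const, smul_eq_mul, ← hW, mul_comm W] at this
    have h3 : ∫ x in closedBall (0 : E) k, ‖h x‖ ≤ ∫ z, cutoff ((2 * k : ℝ)⁻¹ • z) * h z := by
      rw [← integral_indicator measurableSet_closedBall]
      refine integral_mono ((integrable_indicator_iff measurableSet_closedBall).2 (hloc k).norm)
        (hcut _ hk0) fun z => ?_
      by_cases hz : z ∈ closedBall (0 : E) k
      · simp only
        rw [Set.indicator_of_mem hz, cutoff_eq_one, one_mul, Real.norm_of_nonneg (hh0 _)]
        rw [norm_smul, norm_inv, Real.norm_of_nonneg hk0.le, ← div_eq_inv_mul, div_le_iff₀ hk0]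
        have : ‖z‖ ≤ k := by simpa using hz
        linarith
      · simp only
        rw [Set.indicator_of_notMem hz]
        exact mul_nonneg (cutoff_nonneg _) (hh0 _)
    have h4 := mul_le_mul_of_nonneg_left h2 hC
    linarith
  refine ⟨hInt, ?_⟩
  have l1 : Tendsto (fun R : ℝ => ∫ z, cutoff (R⁻¹ • z) * h z) atTop (𝓝 (∫ z, h z)) := by
    refine tendsto_integral_filter_of_dominated_convergence h
      (Eventually.of_forall fun R => (hcutm _).aestronglyMeasurable.mul hhm)
      (Eventually.of_forall fun R => Eventually.of_forall fun z => ?_) hInt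
      (Eventually.of_forall fun z => ?_)
    · rw [norm_mul, Real.norm_of_nonneg (cutoff_nonneg _), Real.norm_of_nonneg (hh0 _)]
      exact mul_le_of_le_one_left (hh0 _) (cutoff_le_one _)
    · have h1 : Tendsto (fun R : ℝ => cutoff (R⁻¹ • z)) atTop (𝓝 (cutoff ((0 : ℝ) • z))) :=
        ((contDiff_cutoff.continuous.tendsto _).comp
          (tendsto_inv_atTop_zero.smul_const z))
      rw [zero_smul, cutoff_eq_one (by simp)] at h1
      simpa using h1.mul_const (h z)
  have hbd : ∀ η : ℝ, 0 < η → |κ * w 0 - ∫ z, h z| ≤ C * (η * W) := fun η hη => by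
    have l2 : Tendsto (fun R : ℝ => C * (η * W + η ^ (1 - p) * ((R ^ 4)⁻¹ * ∫ z, h z))) atTop
        (𝓝 (C * (η * W + η ^ (1 - p) * (0 * ∫ z, h z)))) :=
      ((((tendsto_inv_atTop_zero.comp (tendsto_pow_atTop (by norm_num))).mul_const _).const_mul
        _).const_add _).const_mul _
    rw [zero_mul, mul_zero, add_zero] at l2
    refine le_of_tendsto_of_tendsto (l1.const_sub _).abs l2 ?_
    filter_upwards [eventually_gt_atTop 0] with R hR
    refine (hrep' R hR).trans (mul_le_mul_of_nonneg_left ?_ hC)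
    have hR' : Integrable fun y : E => h (R • y) := hInt.comp_smul hR.ne'
    have e1 : ∫ y : E, R ^ ((Module.finrank ℝ E : ℝ) - 4) * h (R • y) =
        (R ^ 4)⁻¹ * ∫ z, h z := by
      have h1 := integral_comp_affine h 0 hR
      simp only [zero_add] at h1
      rw [integral_const_mul, h1, ← mul_assoc, Real.rpow_sub hR, Real.rpow_natCast]
      congr 1
      have : R ^ (4 : ℝ) = R ^ 4 := by norm_cast
      rw [this]
      field_simp
    have h2 : ∀ᵐ y : E ∂volume.restrict (closedBall 0 1), w (R • y) ≤
        η + η ^ (1 - p) * (R ^ ((Module.finrank ℝ E : ℝ) - 4) * h (R • y)) := by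
      filter_upwards [ae_restrict_mem measurableSet_closedBall,
        ae_restrict_of_ae (compl_mem_ae_iff.2 (measure_singleton (0 : E)))] with y hy hy0
      refine (le_add_rpow_mul hp hη (hw0 _)).trans ?_
      gcongr
      have hy1 : ‖y‖ ≤ 1 := by simpa using hy
      have hy2 : 0 < ‖y‖ := norm_pos_iff.2 hy0
      rw [hh]
      simp only
      rw [norm_smul, Real.norm_of_nonneg hR.le, Real.mul_rpow hR.le hy2.le, ← mul_assoc,
        ← mul_assoc, ← Real.rpow_add hR, add_neg_cancel, Real.rpow_zero, one_mul]
      exact le_mul_of_one_le_left (Real.rpow_nonneg (hw0 _) _)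
        (Real.one_le_rpow_of_pos_of_le_one_of_nonpos hy2 hy1 (by linarith))
    have i1 : IntegrableOn (fun _ : E => η) (closedBall (0 : E) 1) :=
      integrableOn_const (isCompact_closedBall (0 : E) 1).measure_lt_top.ne
    have i2 : Integrable fun y : E =>
      η ^ (1 - p) * (R ^ ((Module.finrank ℝ E : ℝ) - 4) * h (R • y)) :=
      (hR'.const_mul _).const_mul _
    calc _ ≤ ∫ y in closedBall (0 : E) 1,
          (η + η ^ (1 - p) * (R ^ ((Module.finrank ℝ E : ℝ) - 4) * h (R • y))) :=
        integral_mono_ae (hwR R) (i1.add i2.integrableOn) h2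
      _ = η * W + ∫ y in closedBall (0 : E) 1,
          η ^ (1 - p) * (R ^ ((Module.finrank ℝ E : ℝ) - 4) * h (R • y)) := by
        rw [integral_add i1 i2.integrableOn, setIntegral_const, ← hW, smul_eq_mul, mul_comm W]
      _ ≤ η * W + ∫ y, η ^ (1 - p) * (R ^ ((Module.finrank ℝ E : ℝ) - 4) * h (R • y)) := by
        refine add_le_add_right (setIntegral_le_integral i2 (Eventually.of_forall fun y => ?_)) _
        exact mul_nonneg (by positivity) (mul_nonneg (by positivity) (hh0 _))
      _ = _ := by rw [integral_const_mul, e1]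
  have l3 : Tendsto (fun η : ℝ => C * (η * W)) (𝓝[>] 0) (𝓝 (C * (0 * W))) :=
    ((tendsto_id.mono_left nhdsWithin_le_nhds).mul_const W).const_mul C
  have h5 : |κ * w 0 - ∫ z, h z| ≤ 0 := by
    refine ge_of_tendsto (by simpa using l3) ?_
    filter_upwards [self_mem_nhdsWithin] with η hη using hbd η hη
  exact sub_eq_zero.1 (abs_nonpos_iff.1 h5)

/-- Bounded nonnegative weak solutions on the whole space vanish in the subcritical range. -/
theorem WeakSol.eq_zero (hd : 5 ≤ Module.finrank ℝ E) (b : OrthonormalBasis ι ℝ E) {p A : ℝ}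
    (hp : 1 < p) (hpd : ((Module.finrank ℝ E : ℝ) - 4) * p < Module.finrank ℝ E + 4) {w : E → ℝ}
    (hw : Continuous w) (hw0 : ∀ x, 0 ≤ w x) (hwA : ∀ x, w x ≤ A) (hsol : WeakSol b p w) (x : E) :
    w x = 0 := by
  obtain ⟨κ, hκ, hrep⟩ := exists_integral_rep hd b
  have h1 := fun x => hrep p (fun y => w (x + y)) A hp
    (hw.comp (continuous_const.add continuous_id))
    (fun _ => hw0 _) (fun _ => hwA _) (hsol.translate x)
  have e : ∀ x y : E, ‖x - y‖ = ‖-x + y‖ := fun x y => by rw [← norm_neg]; congr 1; abel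
  refine liouville_integral hd hp hpd (inv_pos.2 hκ) hw hw0 hwA (fun x => ?_) (fun x => ?_) x
  · have := (h1 x).1.comp_add_left (-x)
    simpa [e] using this
  · rw [eq_inv_mul_iff_mul_eq₀ hκ.ne']
    have h2 := (h1 x).2
    rw [add_zero] at h2
    rw [h2, ← integral_add_left_eq_self _ (-x)]
    simp [e]

end WeakLiouville

section DerivativeNorms

open Topology
open scoped ContDiff

variable {E : Type*} [NormedAddCommGroup E] [InnerProductSpace ℝ E] {ι : Type*} [Fintype ι]

lemma iteratedFDeriv_apply_eq_ddl {u : E → ℝ} {U : Set E} (hU : IsOpen U) :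
    ∀ {k : ℕ}, ContDiffOn ℝ k u U → ∀ x ∈ U, ∀ m : Fin k → E,
      iteratedFDeriv ℝ k u x m = ddl (List.ofFn m) u x
  | 0, _, x, _, m => by simp
  | k + 1, hu, x, hx, m => by
    have h1 : ContDiffAt ℝ (k + 1 : ℕ) u x := hu.contDiffAt (hU.mem_nhds hx)
    have h2 : DifferentiableAt ℝ (iteratedFDeriv ℝ k u) x :=
      h1.differentiableAt_iteratedFDeriv (by exact_mod_cast Nat.lt_succ_self k)
    have h3 : (fun y => iteratedFDeriv ℝ k u y (Fin.tail m)) =ᶠ[𝓝 x]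
        ddl (List.ofFn (Fin.tail m)) u := by
      filter_upwards [hU.mem_nhds hx] with y hy
      exact iteratedFDeriv_apply_eq_ddl hU (hu.of_le (by exact_mod_cast Nat.le_succ k)) y hy _
    rw [iteratedFDeriv_succ_apply_left, List.ofFn_succ, ddl_cons, dd]
    change _ = fderiv ℝ (ddl (List.ofFn (Fin.tail m)) u) x (m 0)
    rw [← h3.fderiv_eq, fderiv_continuousMultilinear_apply_const_apply h2]

lemma norm_iteratedFDeriv_le_sum (b : OrthonormalBasis ι ℝ E) {u : E → ℝ} {U : Set E}
    (hU : IsOpen U) {k : ℕ} (hu : ContDiffOn ℝ k u U) {x : E} (hx : x ∈ U) :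
    ‖iteratedFDeriv ℝ k u x‖ ≤ ∑ f : Fin k → ι, |ddl (List.ofFn fun i => b (f i)) u x| := by
  classical
  refine ContinuousMultilinearMap.opNorm_le_bound (by positivity) fun m => ?_
  have h1 : m = fun i => ∑ j, inner ℝ (b j) (m i) • b j := by
    ext1 i
    exact (b.sum_repr' (m i)).symm
  have h2 : iteratedFDeriv ℝ k u x m = ∑ f : Fin k → ι,
      (∏ i, inner ℝ (b (f i)) (m i)) * ddl (List.ofFn fun i => b (f i)) u x := by
    conv_lhs => rw [h1]
    rw [ContinuousMultilinearMap.map_sum]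
    refine Finset.sum_congr rfl fun f _ => ?_
    rw [ContinuousMultilinearMap.map_smul_univ, smul_eq_mul, iteratedFDeriv_apply_eq_ddl hU hu x hx]
  rw [h2, Finset.sum_mul]
  refine (norm_sum_le _ _).trans (Finset.sum_le_sum fun f _ => ?_)
  rw [norm_mul, norm_prod, mul_comm, Real.norm_eq_abs]
  gcongr with i
  refine (norm_inner_le_norm _ _).trans ?_
  simp

end DerivativeNorms

section Solutions

open Topology
open scoped ContDiff

variable {E : Type*} [NormedAddCommGroup E] [InnerProductSpace ℝ E] [FiniteDimensional ℝ E]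
  [MeasurableSpace E] [BorelSpace E] {ι : Type*} [Fintype ι]

/-- Interior estimates for the derivatives of order at most `3`. -/
lemma exists_norm_iteratedFDeriv_le (hd : 5 ≤ Module.finrank ℝ E) (b : OrthonormalBasis ι ℝ E)
    {k : ℕ} (hk : k ≤ 3) :
    ∃ C, 0 ≤ C ∧ ∀ (v : E → ℝ) (U : Set E) (A : ℝ), IsOpen U → closedBall 0 1 ⊆ U →
      ContDiffOn ℝ 4 v U → (∀ y ∈ closedBall (0 : E) 1, |v y| ≤ A) →
      (∀ y ∈ closedBall (0 : E) 1, |dlap b (dlap b v) y| ≤ A) →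
      ‖iteratedFDeriv ℝ k v 0‖ ≤ C * A := by
  have h := fun f : Fin k → ι => exists_ddl_le hd b (List.ofFn fun i => b (f i)) (by simpa using hk)
  choose C hC h using h
  refine ⟨∑ f, C f, Finset.sum_nonneg fun f _ => hC f, fun v U A hU hBU hv hvA hvB => ?_⟩
  refine (norm_iteratedFDeriv_le_sum b hU (hv.of_le ?_) (hBU (by simp))).trans ?_
  · exact_mod_cast hk.trans (by norm_num)
  · rw [Finset.sum_mul]
    exact Finset.sum_le_sum fun f _ => h f v U A hU hBU hv hvA hvB

/-- Nonnegative classical solutions of `Δ²v = v ^ p` on a set. -/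
structure SolOn (b : ι → E) (p : ℝ) (v : E → ℝ) (U : Set E) : Prop where
  contDiffOn : ContDiffOn ℝ 4 v U
  nonneg : ∀ y ∈ U, 0 ≤ v y
  eq : ∀ y ∈ U, dlap b (dlap b v) y = v y ^ p

lemma SolOn.comp_affine {b : ι → E} {p : ℝ} {v : E → ℝ} {U : Set E} (hp : 1 < p)
    (h : SolOn b p v U) (x : E) {μ : ℝ} (hμ : 0 < μ) {V : Set E} (hV : ∀ y ∈ V, x + μ • y ∈ U) :
    SolOn b p (fun y => μ ^ (4 / (p - 1)) * v (x + μ • y)) V where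
  contDiffOn := contDiffOn_const.mul
    (h.1.comp (contDiff_const.add (contDiff_const_smul μ)).contDiffOn hV)
  nonneg y hy := mul_nonneg (by positivity) (h.2 _ (hV y hy))
  eq y hy := by
    have hp' : p - 1 ≠ 0 := by linarith
    have e : μ ^ (4 / (p - 1)) * μ ^ 4 = (μ ^ (4 / (p - 1))) ^ p := by
      rw [← Real.rpow_natCast, ← Real.rpow_add hμ, ← Real.rpow_mul hμ.le]
      congr 1
      push_cast
      field_simp
      ring
    rw [dlap_const_mul, dlap_const_mul, dlap_dlap_comp_affine,
      Real.mul_rpow (by positivity) (h.2 _ (hV y hy)), ← e]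
    simp only
    rw [h.3 _ (hV y hy)]
    ring

lemma exists_rescaling {b : ι → E} {p : ℝ} (hp : 1 < p) {v : E → ℝ} {U : Set E}
    (hU : closedBall (0 : E) 1 ⊆ U) (h : SolOn b p v U) {M : ℝ} (hM : 0 < M) (h0 : M ≤ v 0) :
    ∃ w, SolOn b p w (ball 0 (M ^ ((p - 1) / 4) / 2)) ∧ w 0 = 1 ∧
      ∀ y ∈ ball (0 : E) (M ^ ((p - 1) / 4) / 2), w y ≤ 2 ^ (4 / (p - 1)) := by
  have hp' : 0 < (p - 1) / 4 := by linarith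
  have hp1 : 4 / (p - 1) = ((p - 1) / 4)⁻¹ := (inv_div _ _).symm
  obtain ⟨α, hα⟩ : ∃ α, α = (p - 1) / 4 := ⟨_, rfl⟩
  rw [← hα] at hp' hp1 ⊢
  have hv : ContinuousOn v (closedBall 0 1) := h.1.continuousOn.mono hU
  obtain ⟨x, hx, hmax⟩ := (isCompact_closedBall (0 : E) 1).exists_isMaxOn ⟨0, by simp⟩
    ((hv.rpow_const fun _ _ => Or.inr hp'.le).mul
      (f := fun y => v y ^ α) (g := fun y => 1 - ‖y‖) (by fun_prop))
  have hmax' : ∀ y, ‖y‖ ≤ 1 → v y ^ α * (1 - ‖y‖) ≤ v x ^ α * (1 - ‖x‖) := fun y hy =>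
    hmax (mem_closedBall_zero_iff.2 hy)
  have hx1 : ‖x‖ ≤ 1 := by simpa using hx
  have hvx := h.2 x (hU hx)
  have hMx : M ^ α ≤ v x ^ α * (1 - ‖x‖) := by
    refine le_trans ?_ (hmax' 0 (by simp))
    rw [norm_zero, sub_zero, mul_one]
    gcongr
  have hMα : 0 < M ^ α := by positivity
  have hvx0 : 0 < v x := by
    refine hvx.lt_of_ne fun h' => ?_
    rw [← h', Real.zero_rpow hp'.ne'] at hMx
    linarith
  obtain ⟨N, hN⟩ : ∃ N, N = v x ^ α := ⟨_, rfl⟩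
  have hN0 : 0 < N := by rw [hN]; positivity
  rw [← hN] at hMx hmax'
  have hNv : N⁻¹ ^ (4 / (p - 1)) = (v x)⁻¹ := by
    rw [hp1, Real.inv_rpow hN0.le, hN, ← Real.rpow_mul hvx, mul_inv_cancel₀ hp'.ne', Real.rpow_one]
  have hball : ∀ y ∈ ball (0 : E) (M ^ α / 2), ‖x + N⁻¹ • y‖ ≤ (1 + ‖x‖) / 2 := fun y hy => by
    have hy1 : ‖y‖ < M ^ α / 2 := by simpa using hy
    have h2 : ‖N⁻¹ • y‖ ≤ (1 - ‖x‖) / 2 := by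
      rw [norm_smul, Real.norm_of_nonneg (by positivity), inv_mul_le_iff₀ hN0]
      linarith
    linarith [norm_add_le x (N⁻¹ • y)]
  have hball' : ∀ y ∈ ball (0 : E) (M ^ α / 2), x + N⁻¹ • y ∈ closedBall (0 : E) 1 :=
    fun y hy => mem_closedBall_zero_iff.2 (by linarith [hball y hy])
  refine ⟨fun y => N⁻¹ ^ (4 / (p - 1)) * v (x + N⁻¹ • y),
    h.comp_affine hp x (inv_pos.2 hN0) fun y hy => hU (hball' y hy), ?_, fun y hy => ?_⟩
  · simp only
    rw [smul_zero, add_zero, hNv, inv_mul_cancel₀ hvx0.ne']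
  · have hz := h.2 _ (hU (hball' y hy))
    have h1 := hmax' _ (mem_closedBall_zero_iff.1 (hball' y hy))
    have hx2 : 0 < 1 - ‖x‖ := pos_of_mul_pos_right (hMα.trans_le hMx) hN0.le
    have h2 : v (x + N⁻¹ • y) ^ α ≤ 2 * N := by
      have h3 : v (x + N⁻¹ • y) ^ α * ((1 - ‖x‖) / 2) ≤
          v (x + N⁻¹ • y) ^ α * (1 - ‖x + N⁻¹ • y‖) := by
        gcongr
        linarith [hball y hy]
      nlinarith
    have h4 : v (x + N⁻¹ • y) ≤ 2 ^ (4 / (p - 1)) * v x := by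
      have h5 := Real.rpow_le_rpow (by positivity) h2 (inv_nonneg.2 hp'.le)
      rwa [Real.mul_rpow zero_le_two hN0.le, Real.rpow_rpow_inv hz hp'.ne', hN,
        Real.rpow_rpow_inv hvx hp'.ne', ← hp1, ← hN] at h5
    simp only
    rwa [hNv, inv_mul_le_iff₀ hvx0, mul_comm]

end Solutions

section Compactness

open Topology
open scoped ContDiff

variable {E : Type*} [NormedAddCommGroup E] [InnerProductSpace ℝ E] [FiniteDimensional ℝ E]
  [MeasurableSpace E] [BorelSpace E] {ι : Type*} [Fintype ι]

/-- Interior derivative estimates for bounded solutions. -/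
lemma exists_norm_iteratedFDeriv_solOn_le (hd : 5 ≤ Module.finrank ℝ E)
    (b : OrthonormalBasis ι ℝ E) {p A : ℝ} (hp : 1 < p) (hA : 0 ≤ A) {k : ℕ} (hk : k ≤ 3) :
    ∃ C, 0 ≤ C ∧ ∀ (v : E → ℝ) (U : Set E) (z : E), IsOpen U → closedBall z 1 ⊆ U →
      SolOn b p v U → (∀ y ∈ U, v y ≤ A) → ‖iteratedFDeriv ℝ k v z‖ ≤ C := by
  obtain ⟨C, hC, h⟩ := exists_norm_iteratedFDeriv_le hd b hk
  refine ⟨C * (A + A ^ p), by positivity, fun v U z hU hzU hv hvA => ?_⟩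
  have hV : IsOpen ((fun y => z + y) ⁻¹' U) := hU.preimage (continuous_const_add z)
  have hv' := hv.comp_affine hp z one_pos (V := (fun y => z + y) ⁻¹' U)
    fun y hy => by simpa using hy
  simp only [Real.one_rpow, one_mul, one_smul] at hv'
  have hBV : closedBall (0 : E) 1 ⊆ (fun y => z + y) ⁻¹' U := fun y hy => hzU (by simpa using hy)
  have h1 := h _ _ (A + A ^ p) hV hBV hv'.1 (fun y hy => ?_) fun y hy => ?_
  · rwa [iteratedFDeriv_comp_add_left, add_zero] at h1
  · rw [abs_of_nonneg (hv'.2 y (hBV hy))]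
    have := hvA _ (hBV hy)
    have : 0 ≤ A ^ p := by positivity
    linarith
  · have h2 := hv'.2 y (hBV hy)
    rw [hv'.3 y (hBV hy), abs_of_nonneg (by positivity)]
    have : v (z + y) ^ p ≤ A ^ p := by
      gcongr
      exact hvA _ (hBV hy)
    linarith

lemma exists_lipschitz_solOn (hd : 5 ≤ Module.finrank ℝ E) (b : OrthonormalBasis ι ℝ E)
    {p A : ℝ} (hp : 1 < p) (hA : 0 ≤ A) :
    ∃ L, 0 ≤ L ∧ ∀ (v : E → ℝ) (R : ℝ), SolOn b p v (ball 0 R) → (∀ y ∈ ball 0 R, v y ≤ A) →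
      ∀ x ∈ ball (0 : E) (R - 1), ∀ y ∈ ball (0 : E) (R - 1), |v x - v y| ≤ L * ‖x - y‖ := by
  obtain ⟨L, hL, h⟩ := exists_norm_iteratedFDeriv_solOn_le hd b hp hA (k := 1) (by norm_num)
  refine ⟨L, hL, fun v R hv hvA x hx y hy => ?_⟩
  rw [← Real.norm_eq_abs]
  refine (convex_ball (0 : E) (R - 1)).norm_image_sub_le_of_norm_fderiv_le (𝕜 := ℝ) (fun z hz => ?_)
    (fun z hz => ?_) hy hx
  · exact (hv.1.contDiffAt (isOpen_ball.mem_nhds (ball_subset_ball (by linarith)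
      hz))).differentiableAt (by norm_num)
  · have h1 := h v (ball 0 R) z isOpen_ball (closedBall_subset_ball' (by
      have := mem_ball.1 hz
      linarith)) hv hvA
    rwa [norm_iteratedFDeriv_one] at h1

/-- Equibounded solutions on balls exhausting the space subconverge to a weak solution. -/
lemma exists_weakSol_limit (hd : 5 ≤ Module.finrank ℝ E) (b : OrthonormalBasis ι ℝ E) {p A : ℝ}
    (hp : 1 < p) (hA : 0 ≤ A) {w : ℕ → E → ℝ} {R : ℕ → ℝ} (hR : Tendsto R atTop atTop)
    (hw : ∀ j, SolOn b p (w j) (ball 0 (R j))) (hwA : ∀ j, ∀ y ∈ ball 0 (R j), w j y ≤ A) :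
    ∃ (θ : ℕ → ℕ) (W : E → ℝ), StrictMono θ ∧ Continuous W ∧ (∀ x, 0 ≤ W x) ∧ (∀ x, W x ≤ A) ∧
      (∀ x, Tendsto (fun j => w (θ j) x) atTop (𝓝 (W x))) ∧ WeakSol b p W := by
  obtain ⟨L, hL, hlip⟩ := exists_lipschitz_solOn hd b hp hA
  replace hlip := fun j => hlip (w j) (R j) (hw j) (hwA j)
  obtain ⟨g, -, θ, hθ, hg⟩ :=
    (isCompact_univ_pi fun _ : ℕ => isCompact_Icc (a := (0 : ℝ)) (b := A)).tendsto_subseq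
    (x := fun j k => max 0 (min A (w j (TopologicalSpace.denseSeq E k))))
    fun j k _ => ⟨le_max_left _ _, max_le hA (min_le_left _ _)⟩
  have hRθ : Tendsto (fun j => R (θ j)) atTop atTop := hR.comp hθ.tendsto_atTop
  have hev : ∀ x : E, ∀ r : ℝ, ∀ᶠ j in atTop, x ∈ ball (0 : E) (R (θ j) - r) := fun x r => by
    filter_upwards [hRθ.eventually_gt_atTop (‖x‖ + r)] with j hj
    rw [mem_ball_zero_iff]
    linarith
  have hdense : ∀ k,
      Tendsto (fun j => w (θ j) (TopologicalSpace.denseSeq E k)) atTop (𝓝 (g k)) := by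
    intro k
    refine (tendsto_pi_nhds.1 hg k).congr' ?_
    filter_upwards [hev (TopologicalSpace.denseSeq E k) 0] with j hj
    rw [sub_zero] at hj
    simp only [Function.comp]
    rw [min_eq_right (hwA _ _ hj), max_eq_right ((hw _).2 _ hj)]
  have hlim : ∀ x, ∃ l, Tendsto (fun j => w (θ j) x) atTop (𝓝 l) := fun x => by
    refine cauchySeq_tendsto_of_complete (Metric.cauchySeq_iff'.2 fun ε hε => ?_)
    obtain ⟨k, hk⟩ : ∃ k, dist x (TopologicalSpace.denseSeq E k) < ε / (4 * (L + 1)) :=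
      (TopologicalSpace.denseRange_denseSeq E).exists_dist_lt x (by positivity)
    obtain ⟨N₁, h1⟩ := Metric.cauchySeq_iff.1 (hdense k).cauchySeq (ε / 2) (by positivity)
    obtain ⟨N₂, h2⟩ := eventually_atTop.1 ((hev x 1).and (hev (TopologicalSpace.denseSeq E k) 1))
    have h3 : ∀ j ≥ N₂, |w (θ j) x - w (θ j) (TopologicalSpace.denseSeq E k)| ≤ ε / 4 :=
      fun j hj => by
      refine (hlip _ _ (h2 j hj).1 _ (h2 j hj).2).trans ?_
      rw [← dist_eq_norm]
      calc L * dist x _ ≤ (L + 1) * (ε / (4 * (L + 1))) := by gcongr; linarith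
        _ = ε / 4 := by field_simp
    refine ⟨max N₁ N₂, fun j hj => ?_⟩
    have h4 := h3 j ((le_max_right _ _).trans hj)
    have h5 := h3 _ (le_max_right N₁ N₂)
    have h6 := h1 j ((le_max_left _ _).trans hj) _ (le_max_left N₁ N₂)
    rw [Real.dist_eq] at h6 ⊢
    rw [abs_lt] at h6 ⊢
    rw [abs_le] at h4 h5
    constructor <;> linarith
  choose W hW using hlim
  have hW0 : ∀ x, 0 ≤ W x := fun x => by
    refine ge_of_tendsto (hW x) ?_
    filter_upwards [hev x 0] with j hj using (hw _).2 _ (by simpa using hj)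
  have hWA : ∀ x, W x ≤ A := fun x => by
    refine le_of_tendsto (hW x) ?_
    filter_upwards [hev x 0] with j hj using hwA _ _ (by simpa using hj)
  have hWL : ∀ x y, |W x - W y| ≤ L * ‖x - y‖ := fun x y => by
    refine le_of_tendsto ((hW x).sub (hW y)).abs ?_
    filter_upwards [hev x 1, hev y 1] with j hx hy using hlip _ x hx y hy
  have hWc : Continuous W := by
    refine (LipschitzWith.of_dist_le_mul (K := ⟨L, hL⟩) fun x y => ?_).continuous
    rw [Real.dist_eq, dist_eq_norm]
    exact hWL x y
  refine ⟨θ, W, hθ, hWc, hW0, hWA, hW, fun φ hφ hc => ?_⟩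
  have hφ2 := (hφ.dlap_infty b).dlap_infty b
  have hs2 : tsupport (dlap b (dlap b φ)) ⊆ tsupport φ :=
    (tsupport_dlap_subset b _).trans (tsupport_dlap_subset b _)
  have hc2 : HasCompactSupport (dlap b (dlap b φ)) :=
    hc.of_isClosed_subset (isClosed_tsupport _) hs2
  obtain ⟨ρ, hρ⟩ := hc.isCompact.isBounded.subset_ball 0
  have hsub : ∀ᶠ j in atTop, tsupport φ ⊆ ball 0 (R (θ j)) := by
    filter_upwards [hRθ.eventually_ge_atTop ρ] with j hj using hρ.trans (ball_subset_ball hj)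
  have key : ∀ {ψ : E → ℝ} {G : ℝ → ℝ} {B : ℝ}, Continuous ψ → HasCompactSupport ψ →
      tsupport ψ ⊆ tsupport φ → Continuous G → (∀ t ∈ Set.Icc 0 A, |G t| ≤ B) →
      Tendsto (fun j => ∫ y, ψ y * G (w (θ j) y)) atTop (𝓝 (∫ y, ψ y * G (W y))) := by
    intro ψ G B hψ hψc hψs hG hGB
    refine tendsto_integral_filter_of_dominated_convergence (fun y => ‖ψ y‖ * B) ?_ ?_
      ((hψ.integrable_of_hasCompactSupport hψc).norm.mul_const _) ?_
    · filter_upwards [hsub] with j hj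
      exact (integrable_mul_of_tsupport hψ hψc isOpen_ball (hψs.trans hj)
        (hG.comp_continuousOn (hw _).1.continuousOn)).aestronglyMeasurable
    · filter_upwards [hsub] with j hj
      refine Eventually.of_forall fun y => ?_
      by_cases hy : y ∈ tsupport φ
      · rw [norm_mul]
        exact mul_le_mul_of_nonneg_left (hGB _ ⟨(hw _).2 _ (hj hy), hwA _ _ (hj hy)⟩)
            (norm_nonneg _)
      · rw [image_eq_zero_of_notMem_tsupport fun h => hy (hψs h)]
        simp
    · exact Eventually.of_forall fun y => ((hG.tendsto _).comp (hW y)).const_mul _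
  have l1 := key (B := A) hφ2.continuous hc2 hs2 continuous_id fun t ht => by
    rw [id, abs_of_nonneg ht.1]
    exact ht.2
  have l2 := key (G := fun t => t ^ p) (B := A ^ p) hφ.continuous hc subset_rfl
    (Real.continuous_rpow_const (by linarith)) fun t ht => by
      rw [abs_of_nonneg (Real.rpow_nonneg ht.1 _)]
      exact Real.rpow_le_rpow ht.1 ht.2 (by linarith)
  refine tendsto_nhds_unique l1 (l2.congr' ?_)
  filter_upwards [hsub] with j hj
  simp only [id]
  rw [integral_dlap_dlap_mul b hφ hc isOpen_ball hj (hw _).1]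
  congr 1
  ext y
  by_cases hy : y ∈ tsupport φ
  · rw [(hw _).3 y (hj hy)]
  · rw [image_eq_zero_of_notMem_tsupport hy]
    simp

/-- A universal bound at the centre of a ball, by blow-up. -/
theorem exists_solOn_le (hd : 5 ≤ Module.finrank ℝ E) (b : OrthonormalBasis ι ℝ E) {p : ℝ}
    (hp : 1 < p) (hpd : ((Module.finrank ℝ E : ℝ) - 4) * p < Module.finrank ℝ E + 4) :
    ∃ C, 0 ≤ C ∧ ∀ (v : E → ℝ) (U : Set E), closedBall 0 1 ⊆ U → SolOn b p v U → v 0 ≤ C := by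
  by_contra! H
  choose v U hU hv hv0 using fun j : ℕ => H (j + 1) (by positivity)
  choose w hw hw0 hwA using fun j : ℕ =>
    exists_rescaling hp (hU j) (hv j) (by positivity : (0 : ℝ) < j + 1) (hv0 j).le
  have hp' : 0 < (p - 1) / 4 := by linarith
  have hR : Tendsto (fun j : ℕ => ((j : ℝ) + 1) ^ ((p - 1) / 4) / 2) atTop atTop :=
    (((tendsto_rpow_atTop hp').comp (tendsto_atTop_add_const_right _ _
      tendsto_natCast_atTop_atTop))).atTop_div_const two_pos
  obtain ⟨θ, W, -, hWc, hW0, hWA, hW, hsol⟩ :=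
    exists_weakSol_limit hd b hp (by positivity) hR hw hwA
  have h1 := hsol.eq_zero hd b hp hpd hWc hW0 hWA 0
  have h2 := hW 0
  simp only [hw0, h1] at h2
  exact one_ne_zero (tendsto_nhds_unique tendsto_const_nhds h2)

end Compactness

section Decay

open Topology
open scoped ContDiff

variable {E : Type*} [NormedAddCommGroup E] [InnerProductSpace ℝ E] [FiniteDimensional ℝ E]
  [MeasurableSpace E] [BorelSpace E] {ι : Type*} [Fintype ι]

lemma iteratedFDeriv_comp_affine {v : E → ℝ} {U : Set E} (hU : IsOpen U) {k : ℕ}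
    (hv : ContDiffOn ℝ k v U) {z : E} (hz : z ∈ U) (a c : ℝ) :
    iteratedFDeriv ℝ k (fun y => a * v (z + c • y)) 0 = (a * c ^ k) • iteratedFDeriv ℝ k v z := by
  have hc : Continuous fun y : E => z + c • y := by fun_prop
  have hw : ContDiffOn ℝ k (fun y => a * v (z + c • y)) ((fun y => z + c • y) ⁻¹' U) :=
    contDiffOn_const.mul (hv.comp (contDiff_const.add (contDiff_const_smul c)).contDiffOn
      fun _ h => h)
  ext m
  rw [iteratedFDeriv_apply_eq_ddl (hU.preimage hc) hw 0 (by simpa using hz), ddl_const_mul,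
    ddl_comp_affine, smul_apply, iteratedFDeriv_apply_eq_ddl hU hv z hz]
  simp [mul_assoc]

lemma exists_rpow_mul_le (hd : 5 ≤ Module.finrank ℝ E) (b : OrthonormalBasis ι ℝ E) {p : ℝ}
    (hp : 1 < p) (hpd : ((Module.finrank ℝ E : ℝ) - 4) * p < Module.finrank ℝ E + 4) :
    ∃ C, 0 ≤ C ∧ ∀ (v : E → ℝ) (U : Set E) (z : E) (ρ : ℝ), 0 < ρ → closedBall z ρ ⊆ U →
      SolOn b p v U → ρ ^ (4 / (p - 1)) * v z ≤ C := by
  obtain ⟨C, hC, h⟩ := exists_solOn_le hd b hp hpd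
  refine ⟨C, hC, fun v U z ρ hρ hU hv => ?_⟩
  have := h _ (closedBall 0 1) subset_rfl (hv.comp_affine hp z hρ fun y hy => hU ?_)
  · simpa using this
  · rw [mem_closedBall, dist_eq_norm, add_sub_cancel_left, norm_smul, Real.norm_of_nonneg hρ.le]
    exact mul_le_of_le_one_right hρ.le (by simpa using hy)

/-- Scale invariant interior estimates for solutions of the subcritical equation. -/
theorem exists_rpow_mul_norm_iteratedFDeriv_le (hd : 5 ≤ Module.finrank ℝ E)
    (b : OrthonormalBasis ι ℝ E) {p : ℝ} (hp : 1 < p)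
    (hpd : ((Module.finrank ℝ E : ℝ) - 4) * p < Module.finrank ℝ E + 4) {k : ℕ} (hk : k ≤ 3) :
    ∃ C, 0 ≤ C ∧ ∀ (v : E → ℝ) (U : Set E) (z : E) (ρ : ℝ), IsOpen U → 0 < ρ →
      closedBall z (2 * ρ) ⊆ U → SolOn b p v U →
      ρ ^ (4 / (p - 1) + k) * ‖iteratedFDeriv ℝ k v z‖ ≤ C := by
  obtain ⟨C₀, hC₀, h0⟩ := exists_rpow_mul_le hd b hp hpd
  have hA : 0 ≤ 2 ^ (4 / (p - 1)) * C₀ := by positivity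
  obtain ⟨C, hC, h⟩ := exists_norm_iteratedFDeriv_solOn_le hd b hp hA hk
  refine ⟨C, hC, fun v U z ρ hU hρ hzU hv => ?_⟩
  have hball : ∀ y ∈ ball (0 : E) (3 / 2), closedBall (z + ρ • y) (ρ / 2) ⊆ U := fun y hy => by
    refine (closedBall_subset_closedBall' ?_).trans hzU
    have hy' : ‖y‖ < 3 / 2 := by simpa using hy
    rw [dist_eq_norm, add_sub_cancel_left, norm_smul, Real.norm_of_nonneg hρ.le]
    nlinarith
  have h1 := h _ (ball 0 (3 / 2)) 0 isOpen_ball (closedBall_subset_ball (by norm_num))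
    (hv.comp_affine hp z hρ fun y hy => hball y hy (mem_closedBall_self (by positivity)))
    fun y hy => ?_
  · rw [iteratedFDeriv_comp_affine hU (hv.1.of_le (by exact_mod_cast hk.trans (by norm_num)))
      (hzU (mem_closedBall_self (by positivity))), norm_smul,
      Real.norm_of_nonneg (by positivity)] at h1
    rwa [Real.rpow_add hρ, Real.rpow_natCast]
  · have h2 := h0 v U _ (ρ / 2) (by positivity) (hball y hy) hv
    rw [Real.div_rpow hρ.le zero_le_two, div_mul_eq_mul_div, div_le_iff₀ (by positivity)] at h2
    linarith

end Decay

section EuclideanSpaces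

open Topology

lemma lap_eq_dlap {n : ℕ} {u : EuclideanSpace ℝ (Fin n) → ℝ} {U : Set (EuclideanSpace ℝ (Fin n))}
    (hU : IsOpen U) (hu : ContDiffOn ℝ 2 u U) {x : EuclideanSpace ℝ (Fin n)} (hx : x ∈ U) :
    lap u x = dlap (EuclideanSpace.basisFun (Fin n) ℝ) u x := by
  refine Finset.sum_congr rfl fun i _ => ?_
  rw [iteratedFDeriv_apply_eq_ddl hU hu x hx]
  simp

lemma bilap_eq_dlap_dlap {n : ℕ} {u : EuclideanSpace ℝ (Fin n) → ℝ}
    {U : Set (EuclideanSpace ℝ (Fin n))} (hU : IsOpen U) (hu : ContDiffOn ℝ 4 u U)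
    {x : EuclideanSpace ℝ (Fin n)} (hx : x ∈ U) :
    bilap u x = dlap (EuclideanSpace.basisFun (Fin n) ℝ)
      (dlap (EuclideanSpace.basisFun (Fin n) ℝ) u) x := by
  have h : ContDiffOn ℝ 2 (dlap (EuclideanSpace.basisFun (Fin n) ℝ) u) U :=
    ContDiffOn.dlap _ (hu.of_le (by norm_num)) hU
  have h1 : Set.EqOn (lap u) (dlap (EuclideanSpace.basisFun (Fin n) ℝ) u) U := fun y hy =>
    lap_eq_dlap hU (hu.of_le (by norm_num)) hy
  have h2 : lap u =ᶠ[𝓝 x] dlap (EuclideanSpace.basisFun (Fin n) ℝ) u :=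
    h1.eventuallyEq_of_mem (hU.mem_nhds hx)
  rw [← lap_eq_dlap hU h hx, bilap, lap, lap,
    (Filter.EventuallyEq.iteratedFDeriv ℝ h2 2).eq_of_nhds]

end EuclideanSpaces

/-- Gradient decay estimates at infinity: there is `C₂ = C₂(n,p)` such that
for every nonnegative `C⁴` solution of `Δ²u = u^p` in the exterior domain `{|x| > 1}`,
`∑_{k ≤ 3} |x|^{4/(p-1)+k} |∇ᵏu(x)| ≤ C₂` for `|x| ≥ 4`. -/
theorem stmt_5 (n : ℕ) (hn : 5 ≤ n) (p : ℝ)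
    (hp1 : 1 < p) (hp2 : p < ((n : ℝ) + 4) / ((n : ℝ) - 4)) :
    ∃ C₂ : ℝ, ∀ u : EuclideanSpace ℝ (Fin n) → ℝ,
      ContDiffOn ℝ 4 u {x : EuclideanSpace ℝ (Fin n) | 1 < ‖x‖} →
      (∀ x : EuclideanSpace ℝ (Fin n), 1 < ‖x‖ → 0 ≤ u x) →
      (∀ x : EuclideanSpace ℝ (Fin n), 1 < ‖x‖ → bilap u x = u x ^ p) →
      ∀ x : EuclideanSpace ℝ (Fin n), 4 ≤ ‖x‖ →
        ∑ k ∈ Finset.range 4,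
          ‖x‖ ^ ((4 : ℝ) / (p - 1) + (k : ℝ)) * ‖iteratedFDeriv ℝ k u x‖ ≤ C₂ := by
  have hn' : (5 : ℝ) ≤ n := by exact_mod_cast hn
  have hfr : Module.finrank ℝ (EuclideanSpace ℝ (Fin n)) = n := finrank_euclideanSpace_fin
  have hpd : ((Module.finrank ℝ (EuclideanSpace ℝ (Fin n)) : ℝ) - 4) * p <
      Module.finrank ℝ (EuclideanSpace ℝ (Fin n)) + 4 := by
    rw [hfr, mul_comm]
    exact (lt_div_iff₀ (by linarith)).1 hp2
  have hex : ∀ k ∈ Finset.range 4, k ≤ 3 := fun k hk => Nat.lt_succ_iff.1 (Finset.mem_range.1 hk)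
  choose! C hC h using fun k hk => exists_rpow_mul_norm_iteratedFDeriv_le (k := k)
    (by rw [hfr]; exact hn) (EuclideanSpace.basisFun (Fin n) ℝ) hp1 hpd (hex k hk)
  refine ⟨∑ k ∈ Finset.range 4, 4 ^ ((4 : ℝ) / (p - 1) + (k : ℝ)) * C k,
    fun u hu hu0 heq x hx => Finset.sum_le_sum fun k hk => ?_⟩
  have hU : IsOpen {x : EuclideanSpace ℝ (Fin n) | 1 < ‖x‖} :=
    isOpen_lt continuous_const continuous_norm
  have hsol : SolOn (EuclideanSpace.basisFun (Fin n) ℝ) p u {x | 1 < ‖x‖} :=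
    ⟨hu, hu0, fun y hy => by rw [← bilap_eq_dlap_dlap hU hu hy, heq y hy]⟩
  have h1 := h k hk u _ x (‖x‖ / 4) hU (by linarith) (fun y hy => ?_) hsol
  · rw [Real.div_rpow (norm_nonneg x) (by norm_num), div_mul_eq_mul_div,
      div_le_iff₀ (by positivity)] at h1
    linarith
  · have h2 : ‖y - x‖ ≤ 2 * (‖x‖ / 4) := by rwa [mem_closedBall, dist_eq_norm] at hy
    have h3 := norm_sub_norm_le x y
    rw [norm_sub_rev] at h3
    change 1 < ‖y‖
    linarith
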